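/- arXiv:1010.4664 — 2 statements merged into one kernel-verified Lean document; each statement's English description precedes it below -/
import Mathlib

section
/- Assume k = 1, that is, P(z) = a₁z + a₀ with a₁ ≠ 0, and let f = R·e^P as in the setup. Then Π_0(f) = { ζ ↦ k₀·e^{A₁ζ} : k₀ ∈ ℂ, k₀ ≠ 0, A₁ ∈ ℂ with arg A₁ = arg a₁ } ∪ { ζ ↦ f(C₁ + C₂ζ) : C₁ ∈ ℂ, C₂ a real number with C₂ > 0 }. -/
open Filter Topology Complex

noncomputable section

/-- Locally uniform convergence on `ℂ` with respect to the spherical metric,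
expressed via the Euclidean criterion: near every point, either the functions
converge uniformly to `g` in the Euclidean metric, or they are eventually
nonvanishing there and their reciprocals converge uniformly to `1/g`. -/
def SphLocUnifConv (F : ℕ → ℂ → ℂ) (g : ℂ → ℂ) : Prop :=
  ∀ z₀ : ℂ, ∃ U ∈ 𝓝 z₀,
    TendstoUniformlyOn F g atTop U ∨
    ((∀ᶠ n in atTop, ∀ w ∈ U, F n w ≠ 0) ∧
      TendstoUniformlyOn (fun n w => (F n w)⁻¹) (fun w => (g w)⁻¹) atTop U)

/-- `Π_α(h)` : the set of all nonconstant meromorphic functions `g` on `ℂ` for which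
there exist `z₀ ∈ ℂ`, naturals `k n → ∞`, complex `z n → z₀` and positive reals
`ρ n → 0` such that `ζ ↦ ρ n ^ (-α) * h (k n * z n + k n * ρ n * ζ)` converges to `g`
locally uniformly on `ℂ` in the spherical metric. -/
def PiAlpha (α : ℝ) (h : ℂ → ℂ) : Set (ℂ → ℂ) :=
  { g | MeromorphicOn g Set.univ ∧ (∀ c : ℂ, g ≠ fun _ => c) ∧
      ∃ (z₀ : ℂ) (k : ℕ → ℕ) (z : ℕ → ℂ) (ρ : ℕ → ℝ),
        Tendsto k atTop atTop ∧
        Tendsto z atTop (𝓝 z₀) ∧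
        (∀ n, 0 < ρ n) ∧ Tendsto ρ atTop (𝓝 0) ∧
        SphLocUnifConv
          (fun n ζ => ((ρ n ^ (-α) : ℝ) : ℂ) * h ((k n : ℂ) * z n + (k n : ℂ) * (ρ n : ℂ) * ζ))
          g }

open Bornology

/-- Along an ultrafilter, a map into a proper space either tends to infinity or converges. -/
theorem Ultrafilter.tendsto_norm_atTop_or_exists_tendsto_nhds {ι E : Type*}
    [NormedAddCommGroup E] [ProperSpace E] (l : Ultrafilter ι) (x : ι → E) :
    Tendsto (fun n => ‖x n‖) l atTop ∨ ∃ a, Tendsto x l (𝓝 a) := by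
  by_cases h : ∃ M, ∀ᶠ n in l, ‖x n‖ ≤ M
  · obtain ⟨M, hM⟩ := h
    right
    obtain ⟨a, -, ha⟩ := (isCompact_closedBall (0 : E) M).ultrafilter_le_nhds (l.map x)
      (le_principal_iff.2 (hM.mono fun n hn => by simpa using hn))
    exact ⟨a, ha⟩
  · left
    push Not at h
    refine tendsto_atTop.2 fun M => ?_
    filter_upwards [h M] with n hn using hn.le

/-- Local uniform convergence to a continuous function follows from continuous convergence. -/
theorem sphLocUnifConv_of_forall_tendsto {F : ℕ → ℂ → ℂ} {g : ℂ → ℂ} (hg : Continuous g)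
    (h : ∀ ζ, Tendsto (fun y : ℕ × ℂ => F y.1 y.2) (atTop ×ˢ 𝓝 ζ) (𝓝 (g ζ))) :
    SphLocUnifConv F g := by
  have hloc : TendstoLocallyUniformly F g atTop := by
    refine tendstoLocallyUniformly_iff_forall_tendsto.2 fun ζ => ?_
    have h₁ : Tendsto (fun y : ℕ × ℂ => g y.2) (atTop ×ˢ 𝓝 ζ) (𝓝 (g ζ)) :=
      (hg.tendsto ζ).comp tendsto_snd
    exact (h₁.prodMk_nhds (h ζ)).mono_right (nhds_le_uniformity (g ζ))
  intro ζ
  exact ⟨Metric.closedBall ζ 1, Metric.closedBall_mem_nhds ζ one_pos,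
    Or.inl (tendstoLocallyUniformly_iff_forall_isCompact.1 hloc _ (isCompact_closedBall ζ 1))⟩

/-- At a point where the limit is nonzero, spherical convergence gives convergence of values, and
pointwise convergence of the functions or of their reciprocals nearby. -/
theorem SphLocUnifConv.tendsto_of_ne_zero {F : ℕ → ℂ → ℂ} {g : ℂ → ℂ} (h : SphLocUnifConv F g)
    {ζ : ℂ} (hζ : g ζ ≠ 0) :
    Tendsto (fun n => F n ζ) atTop (𝓝 (g ζ)) ∧
      ((∀ᶠ w in 𝓝 ζ, Tendsto (fun n => F n w) atTop (𝓝 (g w))) ∨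
        ∀ᶠ w in 𝓝 ζ, Tendsto (fun n => (F n w)⁻¹) atTop (𝓝 (g w)⁻¹)) := by
  obtain ⟨U, hU, hF | ⟨-, hF⟩⟩ := h ζ
  · exact ⟨hF.tendsto_at (mem_of_mem_nhds hU), Or.inl (by
      filter_upwards [hU] with w hw using hF.tendsto_at hw)⟩
  · refine ⟨?_, Or.inr (by filter_upwards [hU] with w hw using hF.tendsto_at hw)⟩
    simpa using (hF.tendsto_at (mem_of_mem_nhds hU)).inv₀ (inv_ne_zero hζ)

/-- Spherical convergence at a point: convergence to the value of the limit function, or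
divergence to infinity at a point where the limit function has the conventional value `0`. -/
theorem SphLocUnifConv.tendsto_or {F : ℕ → ℂ → ℂ} {g : ℂ → ℂ} (h : SphLocUnifConv F g) (ζ : ℂ) :
    Tendsto (fun n => F n ζ) atTop (𝓝 (g ζ)) ∨
      (g ζ = 0 ∧ Tendsto (fun n => ‖F n ζ‖) atTop atTop) := by
  by_cases hζ : g ζ = 0
  · obtain ⟨U, hU, hF | ⟨h0, hF⟩⟩ := h ζ
    · exact Or.inl (hF.tendsto_at (mem_of_mem_nhds hU))
    · refine Or.inr ⟨hζ, ?_⟩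
      have h₁ := hF.tendsto_at (mem_of_mem_nhds hU)
      simp only [hζ, inv_zero] at h₁
      have h₂ : Tendsto (fun n => (F n ζ)⁻¹) atTop (𝓝[≠] 0) :=
        tendsto_nhdsWithin_iff.2 ⟨h₁, by
          filter_upwards [h0] with n hn using inv_ne_zero (hn ζ (mem_of_mem_nhds hU))⟩
      simpa using tendsto_norm_atTop_iff_cobounded.2 (tendsto_inv₀_nhdsNE_zero.comp h₂)
  · exact Or.inl (h.tendsto_of_ne_zero hζ).1

/-- A rational function in factored form is asymptotic to a power at infinity. -/
theorem tendsto_factoredRational_div_zpow {m p : ℕ} (γ : Fin m → ℂ) (β : Fin p → ℂ)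
    (lm : Fin m → ℕ) (jp : Fin p → ℕ) :
    Tendsto (fun x : ℂ => ((∏ i, (x - γ i) ^ lm i) / ∏ j, (x - β j) ^ jp j) /
      x ^ ((∑ i, lm i : ℕ) - (∑ j, jp j : ℕ) : ℤ)) (cobounded ℂ) (𝓝 1) := by
  have hlin : ∀ c : ℂ, Tendsto (fun x : ℂ => (x - c) / x) (cobounded ℂ) (𝓝 1) := by
    intro c
    have h : Tendsto (fun x : ℂ => 1 - c * x⁻¹) (cobounded ℂ) (𝓝 1) := by
      simpa using (tendsto_const_nhds (x := (1 : ℂ))).sub (tendsto_inv₀_cobounded.const_mul c)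
    refine h.congr' ?_
    filter_upwards [eventually_ne_cobounded (0 : ℂ)] with x hx
    field_simp
  have hprod : ∀ {q : ℕ} (c : Fin q → ℂ) (e : Fin q → ℕ),
      Tendsto (fun x : ℂ => ∏ i, ((x - c i) / x) ^ e i) (cobounded ℂ) (𝓝 1) := by
    intro q c e
    simpa using tendsto_finsetProd Finset.univ fun i _ => (hlin (c i)).pow (e i)
  have h := (hprod γ lm).div (hprod β jp) one_ne_zero
  rw [div_one] at h
  refine h.congr' ?_
  filter_upwards [eventually_ne_cobounded (0 : ℂ)] with x hx
  simp only [Pi.div_apply, div_pow, Finset.prod_div_distrib, Finset.prod_pow_eq_pow_sum]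
  rw [zpow_sub₀ hx, zpow_natCast, zpow_natCast, div_div_div_comm]

/-- At each point a rational function in factored form is continuous or has a pole, where the
convention for division by zero gives it the value `0`. -/
theorem continuousAt_or_pole_factoredRational {m p : ℕ} (γ : Fin m → ℂ) (β : Fin p → ℂ)
    (hγβ : ∀ i j, γ i ≠ β j) (lm : Fin m → ℕ) (jp : Fin p → ℕ) (x : ℂ) :
    let R : ℂ → ℂ := fun z => (∏ i, (z - γ i) ^ lm i) / ∏ j, (z - β j) ^ jp j
    ContinuousAt R x ∨ (R x = 0 ∧ Tendsto (fun z => ‖R z‖) (𝓝[≠] x) atTop) := by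
  intro R
  have hnum : Continuous fun z : ℂ => ∏ i, (z - γ i) ^ lm i := by fun_prop
  have hden : Continuous fun z : ℂ => ∏ j, (z - β j) ^ jp j := by fun_prop
  by_cases hx : ∏ j, (x - β j) ^ jp j = 0
  · right
    refine ⟨by simp [R, hx], ?_⟩
    obtain ⟨j, -, hj⟩ := Finset.prod_eq_zero_iff.1 hx
    have hxj : x = β j := sub_eq_zero.1 (eq_zero_of_pow_eq_zero hj)
    have hnx : ∏ i, (x - γ i) ^ lm i ≠ 0 :=
      Finset.prod_ne_zero_iff.2 fun i _ =>
        pow_ne_zero _ (sub_ne_zero.2 fun h => hγβ i j (h.symm.trans hxj))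
    have hne : ∀ᶠ z in 𝓝[≠] x, ∀ j, z ≠ β j := by
      refine eventually_all.2 fun i => ?_
      by_cases h : β i = x
      · rw [h]; exact self_mem_nhdsWithin
      · exact (eventually_ne_nhds (Ne.symm h)).filter_mono nhdsWithin_le_nhds
    have hd : Tendsto (fun z : ℂ => ∏ j, (z - β j) ^ jp j) (𝓝[≠] x) (𝓝[≠] 0) := by
      refine tendsto_nhdsWithin_iff.2 ⟨?_, ?_⟩
      · have := (hden.tendsto x).mono_left (nhdsWithin_le_nhds (s := {x}ᶜ))
        rwa [hx] at this
      · filter_upwards [hne] with z hz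
        exact Finset.prod_ne_zero_iff.2 fun i _ => pow_ne_zero _ (sub_ne_zero.2 (hz i))
    have hdi := tendsto_norm_atTop_iff_cobounded.2 (tendsto_inv₀_nhdsNE_zero.comp hd)
    have hn := ((hnum.tendsto x).mono_left (nhdsWithin_le_nhds (s := {x}ᶜ))).norm
    refine (hdi.atTop_mul_pos (norm_pos_iff.2 hnx) hn).congr fun z => ?_
    simp [R, div_eq_mul_inv, mul_comm]
  · exact Or.inl (hnum.continuousAt.div hden.continuousAt hx)

section Asymptotics

variable {ι : Type*} {l : Filter ι} {R : ℂ → ℂ} {d : ℤ}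

theorem tendsto_norm_add_atTop {x h : ι → ℂ} (hx : Tendsto (fun n => ‖x n‖) l atTop)
    (hh : Tendsto (fun n => h n / x n) l (𝓝 0)) :
    Tendsto (fun n => ‖x n + h n‖) l atTop := by
  have h₁ : Tendsto (fun n => ‖1 + h n / x n‖) l (𝓝 1) := by
    simpa using (hh.const_add (1 : ℂ)).norm
  refine (hx.atTop_mul_pos one_pos h₁).congr' ?_
  filter_upwards [hx.eventually_gt_atTop 0] with n hn
  have := norm_pos_iff.1 hn
  rw [← norm_mul]
  congr 1
  field_simp

theorem tendsto_comp_add_div_zpow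
    (hR : Tendsto (fun x => R x / x ^ d) (cobounded ℂ) (𝓝 1)) {x h : ι → ℂ}
    (hx : Tendsto (fun n => ‖x n‖) l atTop) (hh : Tendsto (fun n => h n / x n) l (𝓝 0)) :
    Tendsto (fun n => R (x n + h n) / x n ^ d) l (𝓝 1) := by
  have hxh := tendsto_norm_add_atTop hx hh
  have h₁ := hR.comp (tendsto_norm_atTop_iff_cobounded.1 hxh)
  have h₂ : Tendsto (fun n => (1 + h n / x n) ^ d) l (𝓝 1) := by
    have h₃ : Tendsto (fun n => 1 + h n / x n) l (𝓝 1) := by simpa using hh.const_add (1 : ℂ)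
    simpa using h₃.zpow₀ d (Or.inl one_ne_zero)
  have h₄ := h₁.mul h₂
  rw [one_mul] at h₄
  refine h₄.congr' ?_
  filter_upwards [hx.eventually_gt_atTop 0, hxh.eventually_gt_atTop 0] with n hn hn'
  have hn0 := norm_pos_iff.1 hn
  have hn0' := zpow_ne_zero d (norm_pos_iff.1 hn')
  have : 1 + h n / x n = (x n + h n) / x n := by field_simp
  simp only [Function.comp_apply, this, div_zpow]
  field_simp

theorem tendsto_comp_add_div
    (hR : Tendsto (fun x => R x / x ^ d) (cobounded ℂ) (𝓝 1)) {x h : ι → ℂ}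
    (hx : Tendsto (fun n => ‖x n‖) l atTop) (hh : Tendsto (fun n => h n / x n) l (𝓝 0)) :
    Tendsto (fun n => R (x n + h n) / R (x n)) l (𝓝 1) := by
  have h₁ := tendsto_comp_add_div_zpow hR hx hh
  have h₂ := hR.comp (tendsto_norm_atTop_iff_cobounded.1 hx)
  have h₃ := h₁.div h₂ one_ne_zero
  rw [div_one] at h₃
  refine h₃.congr' ?_
  filter_upwards [hx.eventually_gt_atTop 0] with n hn
  have hn0 := zpow_ne_zero d (norm_pos_iff.1 hn)
  simp only [Pi.div_apply, Function.comp_apply]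
  field_simp

theorem tendsto_div_zero_of_tendsto_norm_atTop {x h : ι → ℂ} {b : ℂ}
    (hx : Tendsto (fun n => ‖x n‖) l atTop) (hh : Tendsto h l (𝓝 b)) :
    Tendsto (fun n => h n / x n) l (𝓝 0) := by
  simpa [div_eq_mul_inv] using
    hh.mul (tendsto_inv₀_cobounded.comp (tendsto_norm_atTop_iff_cobounded.1 hx))

end Asymptotics

section Growth

variable {ι : Type*} {R : ℂ → ℂ} {d : ℤ}

theorem tendsto_norm_div_one_add_norm_zpow {l : Filter ι}
    (hR : Tendsto (fun x => R x / x ^ d) (cobounded ℂ) (𝓝 1)) {x : ι → ℂ}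
    (hx : Tendsto (fun n => ‖x n‖) l atTop) :
    Tendsto (fun n => ‖R (x n)‖ / (1 + ‖x n‖) ^ d) l (𝓝 1) := by
  have h₁ := (hR.comp (tendsto_norm_atTop_iff_cobounded.1 hx)).norm
  have h₂ : Tendsto (fun n => 1 - (1 + ‖x n‖)⁻¹) l (𝓝 1) := by
    simpa using (tendsto_const_nhds (x := (1 : ℝ))).sub
      (tendsto_inv_atTop_zero.comp (tendsto_atTop_add_const_left l 1 hx))
  have h₃ : Tendsto (fun n => (1 - (1 + ‖x n‖)⁻¹) ^ d) l (𝓝 1) := by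
    simpa using h₂.zpow₀ d (Or.inl one_ne_zero)
  have h₄ := h₁.mul h₃
  rw [norm_one, one_mul] at h₄
  refine h₄.congr' ?_
  filter_upwards [hx.eventually_gt_atTop 0] with n hn
  have e : 1 - (1 + ‖x n‖)⁻¹ = ‖x n‖ / (1 + ‖x n‖) := by field_simp; ring
  have hn0 := zpow_ne_zero d hn.ne'
  simp only [Function.comp_apply, e, div_zpow, norm_div, norm_zpow]
  field_simp

theorem inv_pow_natAbs_le_zpow {q K : ℝ} (hq : 0 < q) (hK : 0 < K) (h₁ : q ≤ K)
    (h₂ : q⁻¹ ≤ K) (d : ℤ) : (K⁻¹) ^ d.natAbs ≤ q ^ d := by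
  have h₃ : K⁻¹ ≤ q := by simpa using inv_anti₀ (inv_pos.2 hq) h₂
  have h₄ : K⁻¹ ≤ q⁻¹ := inv_anti₀ hq h₁
  have hKi := (inv_pos.2 hK).le
  rcases Int.natAbs_eq d with h | h
  · rw [h, Int.natAbs_natCast, zpow_natCast]
    exact pow_le_pow_left₀ hKi h₃ _
  · rw [h, Int.natAbs_neg, Int.natAbs_natCast, zpow_neg, zpow_natCast, ← inv_pow]
    exact pow_le_pow_left₀ hKi h₄ _

/-- Moving from `x n` a distance tending to infinity in a direction in which the exponential
grows makes `R * exp` tend to infinity. -/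
theorem tendsto_norm_mul_exp_atTop {l : Filter ι}
    (hR : Tendsto (fun x => R x / x ^ d) (cobounded ℂ) (𝓝 1)) {a₁ a₀ v c : ℂ} {σ ℓ : ℝ}
    (hσ : 0 < σ) (hv : a₁ * v = σ) {r : ι → ℝ} (hr : Tendsto r l atTop) {x : ι → ℂ}
    (hL : Tendsto (fun n => ‖R (x n)‖ / (1 + ‖x n‖) ^ d) l (𝓝 ℓ)) (hℓ : 0 < ℓ)
    (hfx : Tendsto (fun n => R (x n) * Complex.exp (a₁ * x n + a₀)) l (𝓝 c)) (hc : c ≠ 0)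
    (hy : Tendsto (fun n => ‖x n + r n * v‖) l atTop) :
    Tendsto (fun n => ‖R (x n + r n * v) * Complex.exp (a₁ * (x n + r n * v) + a₀)‖)
      l atTop := by
  have hLy := tendsto_norm_div_one_add_norm_zpow hR hy
  set N := d.natAbs
  have hexp : Tendsto (fun n => Real.exp (σ * r n) / r n ^ N) l atTop := by
    simpa using! (tendsto_exp_mul_div_rpow_atTop (N : ℝ) σ hσ).comp hr
  have hpre := (hfx.norm.mul (hLy.div hL hℓ.ne')).mul_const (((1 + ‖v‖)⁻¹) ^ N)
  have hpos : 0 < ‖c‖ * (1 / ℓ) * ((1 + ‖v‖)⁻¹) ^ N := by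
    have := norm_pos_iff.2 hc
    positivity
  refine tendsto_atTop_mono' l ?_ (hexp.atTop_mul_pos hpos hpre)
  filter_upwards [hr.eventually_ge_atTop 1, hL.eventually (lt_mem_nhds hℓ)] with n hrn hLn
  simp only [Pi.div_apply]
  set y := x n + r n * v with hydef
  have hr0 : 0 < r n := by linarith
  have hx0 : 0 < 1 + ‖x n‖ := by positivity
  have hy0 : 0 < 1 + ‖y‖ := by positivity
  have hrv : ‖(r n : ℂ) * v‖ = r n * ‖v‖ := by simp [abs_of_pos hr0]
  have hK : 0 < r n * (1 + ‖v‖) := by positivity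
  have hyx : ‖y‖ ≤ ‖x n‖ + r n * ‖v‖ := hrv ▸ norm_add_le _ _
  have hxy : ‖x n‖ ≤ ‖y‖ + r n * ‖v‖ := by
    have : x n = y - r n * v := by rw [hydef]; ring
    rw [this, ← hrv]
    exact norm_sub_le _ _
  have hq := inv_pow_natAbs_le_zpow (q := (1 + ‖y‖) / (1 + ‖x n‖))
    (div_pos hy0 hx0) hK
    (by rw [div_le_iff₀ hx0]
        nlinarith [norm_nonneg v, norm_nonneg (x n), mul_nonneg hr0.le (norm_nonneg v),
          mul_nonneg (mul_nonneg hr0.le (norm_nonneg v)) (norm_nonneg (x n))])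
    (by rw [inv_div, div_le_iff₀ hy0]
        nlinarith [norm_nonneg v, norm_nonneg y, mul_nonneg hr0.le (norm_nonneg v),
          mul_nonneg (mul_nonneg hr0.le (norm_nonneg v)) (norm_nonneg y)]) d
  have hRx : ‖R (x n)‖ ≠ 0 := by
    intro h
    simp [h] at hLn
  have hey : Complex.exp (a₁ * y + a₀) =
      Complex.exp (a₁ * x n + a₀) * ((Real.exp (σ * r n) : ℝ) : ℂ) := by
    rw [Complex.ofReal_exp, ← Complex.exp_add]
    congr 1
    push_cast
    rw [hydef, ← hv]
    ring
  have heq : ‖R y * Complex.exp (a₁ * y + a₀)‖ =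
      Real.exp (σ * r n) * (‖R (x n) * Complex.exp (a₁ * x n + a₀)‖ *
        (‖R y‖ / (1 + ‖y‖) ^ d / (‖R (x n)‖ / (1 + ‖x n‖) ^ d))) *
          ((1 + ‖y‖) / (1 + ‖x n‖)) ^ d := by
    have hxd := zpow_ne_zero d hx0.ne'
    have hyd := zpow_ne_zero d hy0.ne'
    rw [hey, norm_mul, norm_mul, norm_mul, Complex.norm_real, Real.norm_eq_abs,
      abs_of_pos (Real.exp_pos _), div_zpow]
    field_simp
  rw [heq]
  calc _ = Real.exp (σ * r n) * (‖R (x n) * Complex.exp (a₁ * x n + a₀)‖ *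
        (‖R y‖ / (1 + ‖y‖) ^ d / (‖R (x n)‖ / (1 + ‖x n‖) ^ d))) *
          ((r n * (1 + ‖v‖))⁻¹) ^ N := by
        rw [mul_inv, mul_pow, inv_pow (r n)]
        ring
    _ ≤ _ := mul_le_mul_of_nonneg_left hq (by positivity)

theorem not_tendsto_nhds_pair_of_growing (l : Ultrafilter ι)
    (hR : Tendsto (fun x => R x / x ^ d) (cobounded ℂ) (𝓝 1)) {a₁ a₀ v c c₁ c₂ : ℂ} {σ ℓ : ℝ}
    (hσ : 0 < σ) (hv : a₁ * v = σ) {r : ι → ℝ} (hr : Tendsto r l atTop) {x : ι → ℂ}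
    (hL : Tendsto (fun n => ‖R (x n)‖ / (1 + ‖x n‖) ^ d) l (𝓝 ℓ)) (hℓ : 0 < ℓ)
    (hfx : Tendsto (fun n => R (x n) * Complex.exp (a₁ * x n + a₀)) l (𝓝 c)) (hc : c ≠ 0)
    (h₁ : Tendsto (fun n => R (x n + r n * v) * Complex.exp (a₁ * (x n + r n * v) + a₀))
      l (𝓝 c₁))
    (h₂ : Tendsto (fun n => R (x n + r n * (2 * v)) *
      Complex.exp (a₁ * (x n + r n * (2 * v)) + a₀)) l (𝓝 c₂)) : False := by
  rcases l.tendsto_norm_atTop_or_exists_tendsto_nhds fun n => x n + r n * v with h | ⟨a, ha⟩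
  · exact not_tendsto_atTop_of_tendsto_nhds h₁.norm
      (tendsto_norm_mul_exp_atTop hR hσ hv hr hL hℓ hfx hc h)
  · have hv0 : v ≠ 0 := by
      rintro rfl
      rw [mul_zero] at hv
      exact hσ.ne (by exact_mod_cast hv)
    have hbig : Tendsto (fun n => ‖x n + r n * (2 * v)‖) l atTop := by
      have hrv : Tendsto (fun n => r n * ‖v‖ + -‖x n + r n * v‖) l atTop :=
        (hr.atTop_mul_const (norm_pos_iff.2 hv0)).atTop_add ha.norm.neg
      refine tendsto_atTop_mono' _ ?_ hrv
      filter_upwards [hr.eventually_gt_atTop 0] with n hn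
      have e : (r n : ℂ) * v = (x n + r n * (2 * v)) - (x n + r n * v) := by ring
      have := norm_sub_le (x n + r n * (2 * v)) (x n + r n * v)
      rw [← e, norm_mul, Complex.norm_real, Real.norm_eq_abs, abs_of_pos hn] at this
      linarith
    refine not_tendsto_atTop_of_tendsto_nhds h₂.norm
      (tendsto_norm_mul_exp_atTop hR (σ := 2 * σ) (by linarith) ?_ hr hL hℓ hfx hc hbig)
    push_cast
    rw [← hv]
    ring

end Growth

/-- If `f` is continuous or has a pole (with conventional value `0`) at `x`, then a limit of `f`
along a family converging to `x` is `f x`. -/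
theorem eq_of_tendsto_of_continuousAt_or_pole {ι : Type*} {l : Filter ι} [l.NeBot] {f : ℂ → ℂ}
    {x c : ℂ} (hf : ContinuousAt f x ∨ (f x = 0 ∧ Tendsto (fun z => ‖f z‖) (𝓝[≠] x) atTop))
    {u : ι → ℂ} (hu : Tendsto u l (𝓝 x)) (hc : Tendsto (fun n => f (u n)) l (𝓝 c)) :
    c = f x := by
  rcases hf with hf | ⟨h0, hf⟩
  · exact tendsto_nhds_unique hc (hf.tendsto.comp hu)
  · rw [h0]
    by_contra hne
    have hux : Tendsto u l (𝓝[≠] x) := by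
      refine tendsto_nhdsWithin_iff.2 ⟨hu, ?_⟩
      filter_upwards [hc.eventually_ne hne] with n hn h
      rw [Set.mem_singleton_iff] at h
      exact hn (by rw [h, h0])
    exact not_tendsto_atTop_of_tendsto_nhds hc.norm (hf.comp hux)

section Limits

variable {ι : Type*} {R f g : ℂ → ℂ} {d : ℤ} {a₁ a₀ : ℂ} {w : ι → ℂ} {r : ι → ℝ}

theorem continuousAt_or_pole_mul_exp {x : ℂ}
    (hR : ContinuousAt R x ∨ (R x = 0 ∧ Tendsto (fun z => ‖R z‖) (𝓝[≠] x) atTop))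
    (hf : f = fun z => R z * Complex.exp (a₁ * z + a₀)) :
    ContinuousAt f x ∨ (f x = 0 ∧ Tendsto (fun z => ‖f z‖) (𝓝[≠] x) atTop) := by
  have hexp : Continuous fun z : ℂ => Complex.exp (a₁ * z + a₀) := by fun_prop
  subst hf
  rcases hR with hR | ⟨h0, hR⟩
  · exact Or.inl (hR.mul hexp.continuousAt)
  · refine Or.inr ⟨by simp [h0], ?_⟩
    have := hR.atTop_mul_pos (norm_pos_iff.2 (Complex.exp_ne_zero _))
      (((hexp.tendsto x).mono_left (nhdsWithin_le_nhds (s := {x}ᶜ))).norm)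
    simpa only [norm_mul] using this

/-- Bounded translations and bounded scalings: the limit is an affine reparametrization. -/
theorem eq_comp_affine_of_tendsto {l : Filter ι} [l.NeBot]
    (hf : ∀ x, ContinuousAt f x ∨ (f x = 0 ∧ Tendsto (fun z => ‖f z‖) (𝓝[≠] x) atTop))
    (hg : ∀ ζ, Tendsto (fun n => f (w n + r n * ζ)) l (𝓝 (g ζ)) ∨
      (g ζ = 0 ∧ Tendsto (fun n => ‖f (w n + r n * ζ)‖) l atTop))
    {w₀ : ℂ} {r₀ : ℝ} (hw : Tendsto w l (𝓝 w₀)) (hr : Tendsto r l (𝓝 r₀)) :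
    g = fun ζ => f (w₀ + r₀ * ζ) := by
  funext ζ
  have hu : Tendsto (fun n => w n + r n * ζ) l (𝓝 (w₀ + r₀ * ζ)) :=
    hw.add (((Complex.continuous_ofReal.tendsto r₀).comp hr).mul_const ζ)
  rcases hg ζ with h | ⟨h0, h⟩
  · exact eq_of_tendsto_of_continuousAt_or_pole (hf _) hu h
  · rcases hf (w₀ + r₀ * ζ) with hc | ⟨hz, -⟩
    · exact absurd h (not_tendsto_atTop_of_tendsto_nhds (hc.tendsto.comp hu).norm)
    · rw [h0, hz]

/-- Translations tending to infinity and bounded scalings: the limit is an exponential or zero. -/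
theorem eq_const_mul_exp_of_tendsto {l : Filter ι} [l.NeBot]
    (hR : Tendsto (fun x => R x / x ^ d) (cobounded ℂ) (𝓝 1))
    (hf : f = fun z => R z * Complex.exp (a₁ * z + a₀))
    (hg : ∀ ζ, Tendsto (fun n => f (w n + r n * ζ)) l (𝓝 (g ζ)) ∨
      (g ζ = 0 ∧ Tendsto (fun n => ‖f (w n + r n * ζ)‖) l atTop))
    {r₀ : ℝ} (hw : Tendsto (fun n => ‖w n‖) l atTop) (hr : Tendsto r l (𝓝 r₀)) :
    g = fun ζ => g 0 * Complex.exp (r₀ * a₁ * ζ) := by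
  have hr' : Tendsto (fun n => (r n : ℂ)) l (𝓝 r₀) :=
    (Complex.continuous_ofReal.tendsto r₀).comp hr
  have hRw : ∀ᶠ n in l, R (w n) ≠ 0 := by
    filter_upwards [(hR.comp (tendsto_norm_atTop_iff_cobounded.1 hw)).eventually_ne one_ne_zero]
      with n hn h
    simp [h] at hn
  funext ζ
  set q : ι → ℂ := fun n => R (w n + r n * ζ) / R (w n) * Complex.exp (r n * a₁ * ζ) with hq
  have hqlim : Tendsto q l (𝓝 (Complex.exp (r₀ * a₁ * ζ))) := by
    have h₁ := tendsto_comp_add_div hR hw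
      (tendsto_div_zero_of_tendsto_norm_atTop hw (hr'.mul_const ζ))
    have h₂ := (Complex.continuous_exp.tendsto _).comp ((hr'.mul_const a₁).mul_const ζ)
    simpa using h₁.mul h₂
  have hfac : ∀ᶠ n in l, f (w n) * q n = f (w n + r n * ζ) := by
    filter_upwards [hRw] with n hn
    have e : a₁ * (w n + r n * ζ) + a₀ = (a₁ * w n + a₀) + r n * a₁ * ζ := by ring
    simp only [hf, hq, e, Complex.exp_add (a₁ * w n + a₀)]
    field_simp
  have hg0 := hg 0
  simp only [mul_zero, add_zero] at hg0
  rcases hg0 with h | ⟨h0, h⟩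
  · have hlim := (h.mul hqlim).congr' hfac
    rcases hg ζ with h' | ⟨-, h'⟩
    · exact tendsto_nhds_unique h' hlim
    · exact absurd h' (not_tendsto_atTop_of_tendsto_nhds hlim.norm)
  · have hlim := h.atTop_mul_pos (norm_pos_iff.2 (Complex.exp_ne_zero _)) hqlim.norm
    have hlim' : Tendsto (fun n => ‖f (w n + r n * ζ)‖) l atTop := by
      refine hlim.congr' ?_
      filter_upwards [hfac] with n hn
      rw [← hn]
      exact (norm_mul _ _).symm
    rcases hg ζ with h' | ⟨h', -⟩
    · exact absurd hlim' (not_tendsto_atTop_of_tendsto_nhds h'.norm)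
    · rw [h', h0, zero_mul]

theorem exists_tendsto_norm_div_one_add_norm_zpow (l : Ultrafilter ι)
    (hR : Tendsto (fun x => R x / x ^ d) (cobounded ℂ) (𝓝 1))
    (hRp : ∀ x, ContinuousAt R x ∨ (R x = 0 ∧ Tendsto (fun z => ‖R z‖) (𝓝[≠] x) atTop))
    (hf : f = fun z => R z * Complex.exp (a₁ * z + a₀)) {x : ι → ℂ} {c : ℂ}
    (hfx : Tendsto (fun n => f (x n)) l (𝓝 c)) (hc : c ≠ 0) :
    ∃ ℓ : ℝ, 0 < ℓ ∧ Tendsto (fun n => ‖R (x n)‖ / (1 + ‖x n‖) ^ d) l (𝓝 ℓ) := by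
  rcases l.tendsto_norm_atTop_or_exists_tendsto_nhds x with h | ⟨a, ha⟩
  · exact ⟨1, one_pos, tendsto_norm_div_one_add_norm_zpow hR h⟩
  · have hca := eq_of_tendsto_of_continuousAt_or_pole
      (continuousAt_or_pole_mul_exp (hRp a) hf) ha hfx
    have hRa : R a ≠ 0 := by
      intro h
      exact hc (by simp [hca, hf, h])
    have ha0 : (0 : ℝ) < 1 + ‖a‖ := by positivity
    refine ⟨‖R a‖ / (1 + ‖a‖) ^ d, div_pos (norm_pos_iff.2 hRa) (zpow_pos ha0 d), ?_⟩
    have hcont := (hRp a).resolve_right fun h => hRa h.1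
    exact (hcont.tendsto.comp ha).norm.div
      ((ha.norm.const_add 1).zpow₀ d (Or.inl ha0.ne')) (zpow_ne_zero d ha0.ne.symm)

/-- Scalings tending to infinity have no limit that is nonzero somewhere. -/
theorem SphLocUnifConv.not_tendsto_scale_atTop {w : ℕ → ℂ} {r : ℕ → ℝ} (l : Ultrafilter ℕ)
    (hl : (l : Filter ℕ) ≤ atTop)
    (hR : Tendsto (fun x => R x / x ^ d) (cobounded ℂ) (𝓝 1))
    (hRp : ∀ x, ContinuousAt R x ∨ (R x = 0 ∧ Tendsto (fun z => ‖R z‖) (𝓝[≠] x) atTop))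
    (ha₁ : a₁ ≠ 0) (hf : f = fun z => R z * Complex.exp (a₁ * z + a₀))
    (hg : SphLocUnifConv (fun n ζ => f (w n + r n * ζ)) g) {ζ : ℂ} (hζ : g ζ ≠ 0) :
    ¬ Tendsto r l atTop := by
  intro hr
  obtain ⟨h₀, hnear⟩ := hg.tendsto_of_ne_zero hζ
  replace h₀ := h₀.mono_left hl
  obtain ⟨ℓ, hℓ, hL⟩ := exists_tendsto_norm_div_one_add_norm_zpow l hR hRp hf h₀ hζ
  have hpts : ∀ {p : ℂ → Prop} (b : ℂ), (∀ᶠ z in 𝓝 ζ, p z) →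
      ∃ s : ℝ, 0 < s ∧ p (ζ + s * b) ∧ p (ζ + 2 * (s * b)) := by
    intro p b hp
    have h₁ : Tendsto (fun s : ℝ => ζ + s * b) (𝓝[>] 0) (𝓝 ζ) := by
      have : Continuous fun s : ℝ => ζ + s * b := by fun_prop
      simpa using (this.tendsto 0).mono_left (nhdsWithin_le_nhds (s := Set.Ioi 0))
    have h₂ : Tendsto (fun s : ℝ => ζ + 2 * (s * b)) (𝓝[>] 0) (𝓝 ζ) := by
      have : Continuous fun s : ℝ => ζ + 2 * (s * b) := by fun_prop
      simpa using (this.tendsto 0).mono_left (nhdsWithin_le_nhds (s := Set.Ioi 0))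
    obtain ⟨s, hs, hs'⟩ :=
      ((eventually_mem_nhdsWithin.and (h₁.eventually hp)).and (h₂.eventually hp)).exists
    exact ⟨s, hs.1, hs.2, hs'⟩
  have hshift : ∀ (n : ℕ) (u : ℂ), w n + r n * (ζ + u) = w n + r n * ζ + r n * u := by
    intros
    ring
  rcases hnear with hnear | hnear
  · obtain ⟨s, hs, h₁, h₂⟩ := hpts a₁⁻¹ hnear
    replace h₁ := h₁.mono_left hl
    replace h₂ := h₂.mono_left hl
    simp only [hshift, hf] at h₀ h₁ h₂
    exact not_tendsto_nhds_pair_of_growing l hR hs (by field_simp) hr hL hℓ h₀ hζ h₁ h₂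
  · obtain ⟨s, hs, h₁, h₂⟩ := hpts (-a₁⁻¹) hnear
    replace h₁ := h₁.mono_left hl
    replace h₂ := h₂.mono_left hl
    have hR' : Tendsto (fun x => R⁻¹ x / x ^ (-d)) (cobounded ℂ) (𝓝 1) := by
      have := hR.inv₀ one_ne_zero
      rw [inv_one] at this
      refine this.congr fun x => ?_
      simp [div_eq_mul_inv, mul_comm]
    have hL' : Tendsto (fun n => ‖R⁻¹ (w n + r n * ζ)‖ / (1 + ‖w n + r n * ζ‖) ^ (-d)) l
        (𝓝 ℓ⁻¹) := by
      refine (hL.inv₀ hℓ.ne').congr fun n => ?_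
      simp [div_eq_mul_inv, mul_comm]
    have hfi : ∀ z, (f z)⁻¹ = R⁻¹ z * Complex.exp (-a₁ * z + -a₀) := by
      intro z
      rw [hf, mul_inv, ← Complex.exp_neg]
      congr 2
      ring
    replace h₀ := h₀.inv₀ hζ
    simp only [hshift, hfi] at h₀ h₁ h₂
    exact not_tendsto_nhds_pair_of_growing l hR' hs (by field_simp) hr hL' (inv_pos.2 hℓ) h₀
      (inv_ne_zero hζ) h₁ h₂

end Limits

section Membership

variable {R f g : ℂ → ℂ} {d : ℤ} {a₁ a₀ : ℂ}

/-- Nonconstant limits are exponentials or affine reparametrizations. -/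
theorem eq_exp_or_affine_of_sphLocUnifConv {w : ℕ → ℂ} {r : ℕ → ℝ}
    (hR : Tendsto (fun x => R x / x ^ d) (cobounded ℂ) (𝓝 1))
    (hRp : ∀ x, ContinuousAt R x ∨ (R x = 0 ∧ Tendsto (fun z => ‖R z‖) (𝓝[≠] x) atTop))
    (ha₁ : a₁ ≠ 0) (hf : f = fun z => R z * Complex.exp (a₁ * z + a₀)) (hr : ∀ n, 0 ≤ r n)
    (hg : SphLocUnifConv (fun n ζ => f (w n + r n * ζ)) g) (hne : ∀ c : ℂ, g ≠ fun _ => c) :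
    (∃ k₀ A₁ : ℂ, k₀ ≠ 0 ∧ (∃ t : ℝ, 0 < t ∧ A₁ = (t : ℂ) * a₁) ∧
        g = fun ζ => k₀ * Complex.exp (A₁ * ζ)) ∨
      (∃ (C₁ : ℂ) (C₂ : ℝ), 0 < C₂ ∧ g = fun ζ => f (C₁ + (C₂ : ℂ) * ζ)) := by
  let l : Ultrafilter ℕ := hyperfilter ℕ
  have hl : (l : Filter ℕ) ≤ atTop := Nat.hyperfilter_le_atTop
  obtain ⟨ζ, hζ⟩ : ∃ ζ, g ζ ≠ 0 := by
    by_contra! h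
    exact hne 0 (funext h)
  have hpt : ∀ ζ, Tendsto (fun n => f (w n + r n * ζ)) l (𝓝 (g ζ)) ∨
      (g ζ = 0 ∧ Tendsto (fun n => ‖f (w n + r n * ζ)‖) l atTop) := fun ζ =>
    (hg.tendsto_or ζ).imp (·.mono_left hl) (fun h => ⟨h.1, h.2.mono_left hl⟩)
  rcases l.tendsto_norm_atTop_or_exists_tendsto_nhds r with hrl | ⟨r₀, hrl⟩
  · refine absurd ?_ (hg.not_tendsto_scale_atTop l hl hR hRp ha₁ hf hζ)
    simpa only [Real.norm_eq_abs, abs_of_nonneg (hr _)] using hrl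
  have hr₀ : 0 ≤ r₀ := ge_of_tendsto' hrl hr
  rcases l.tendsto_norm_atTop_or_exists_tendsto_nhds w with hw | ⟨w₀, hw⟩
  · have hg' := eq_const_mul_exp_of_tendsto hR hf hpt hw hrl
    have hg0 : g 0 ≠ 0 := fun h => hne 0 (by rw [hg', h]; simp)
    have hr₀' : r₀ ≠ 0 := by
      rintro rfl
      exact hne (g 0) (by simpa using hg')
    exact Or.inl ⟨g 0, r₀ * a₁, hg0, ⟨r₀, lt_of_le_of_ne hr₀ hr₀'.symm, rfl⟩, hg'⟩
  · have hg' := eq_comp_affine_of_tendsto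
      (fun x => continuousAt_or_pole_mul_exp (hRp x) hf) hpt hw hrl
    have hr₀' : r₀ ≠ 0 := by
      rintro rfl
      exact hne (f w₀) (by simpa using hg')
    exact Or.inr ⟨w₀, r₀, lt_of_le_of_ne hr₀ hr₀'.symm, hg'⟩

theorem cexp_one_ne_one : Complex.exp 1 ≠ 1 := by
  intro h
  have h' : Real.exp 1 = 1 := by
    rw [← Complex.ofReal_inj, Complex.ofReal_exp]
    simpa using h
  simp at h'

theorem mul_exp_ne_const (hR : Tendsto (fun x => R x / x ^ d) (cobounded ℂ) (𝓝 1))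
    (ha₁ : a₁ ≠ 0) (hf : f = fun z => R z * Complex.exp (a₁ * z + a₀)) (c : ℂ) :
    f ≠ fun _ => c := by
  intro h
  have h₁ := tendsto_comp_add_div (l := cobounded ℂ) (x := id) (h := fun _ => a₁⁻¹) hR
    tendsto_norm_cobounded_atTop (tendsto_div_zero_of_tendsto_norm_atTop
      tendsto_norm_cobounded_atTop tendsto_const_nhds)
  have h₂ : ∀ᶠ x in cobounded ℂ, R (id x + a₁⁻¹) / R (id x) = (Complex.exp 1)⁻¹ := by
    filter_upwards [hR.eventually_ne one_ne_zero] with x hx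
    have hRx : R x ≠ 0 := fun h0 => hx (by simp [h0])
    have e : f (x + a₁⁻¹) = f x := by rw [h]
    have e' : a₁ * (x + a₁⁻¹) + a₀ = (a₁ * x + a₀) + 1 := by
      field_simp
      ring
    simp only [hf, e', Complex.exp_add _ (1 : ℂ)] at e
    rw [id, div_eq_iff hRx, ← mul_right_inj' (Complex.exp_ne_zero 1),
      ← mul_right_inj' (Complex.exp_ne_zero (a₁ * x + a₀)),
      mul_inv_cancel_left₀ (Complex.exp_ne_zero 1)]
    linear_combination e
  have h₃ : (Complex.exp 1)⁻¹ = 1 :=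
    tendsto_nhds_unique (tendsto_const_nhds.congr' (h₂.mono fun _ hx => hx.symm)) h₁
  exact cexp_one_ne_one (inv_eq_one.1 h₃)

theorem comp_affine_mem_piAlpha (hmer : Meromorphic f) (hne : ∀ c : ℂ, f ≠ fun _ => c)
    {C₁ : ℂ} {C₂ : ℝ} (hC₂ : 0 < C₂) : (fun ζ => f (C₁ + (C₂ : ℂ) * ζ)) ∈ PiAlpha 0 f := by
  have hC : (C₂ : ℂ) ≠ 0 := by exact_mod_cast hC₂.ne'
  refine ⟨?_, ?_, 0, fun n => n + 1, fun n => C₁ / (n + 1), fun n => C₂ / (n + 1),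
    tendsto_add_atTop_nat 1, ?_, fun n => by positivity, ?_, ?_⟩
  · intro ζ _
    exact (hmer _).comp_analyticAt (by fun_prop)
  · intro c h
    refine hne c (funext fun z => ?_)
    have := congrFun h ((z - C₁) / C₂)
    simpa [mul_div_cancel₀ _ hC] using this
  · simpa [Function.comp_def] using (tendsto_const_div_atTop_nhds_zero_nat C₁).comp (tendsto_add_atTop_nat 1)
  · simpa [Function.comp_def] using (tendsto_const_div_atTop_nhds_zero_nat C₂).comp (tendsto_add_atTop_nat 1)
  · have e : ∀ (n : ℕ) (ζ : ℂ), ((n + 1 : ℕ) : ℂ) * (C₁ / (n + 1)) +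
        ((n + 1 : ℕ) : ℂ) * ((C₂ / (n + 1) : ℝ) : ℂ) * ζ = C₁ + C₂ * ζ := by
      intro n ζ
      have : (n : ℂ) + 1 ≠ 0 := by exact_mod_cast n.succ_ne_zero
      push_cast
      field_simp
    simp only [e, neg_zero, Real.rpow_zero, Complex.ofReal_one, one_mul]
    intro ζ
    refine ⟨Set.univ, univ_mem, Or.inl fun u hu => Eventually.of_forall fun n x _ => ?_⟩
    exact refl_mem_uniformity hu

theorem tendsto_clog_div_self_cobounded :
    Tendsto (fun x : ℂ => Complex.log x / x) (cobounded ℂ) (𝓝 0) := by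
  have h : Tendsto (fun t : ℝ => (|Real.log t| + Real.pi) / t) atTop (𝓝 0) := by
    have h₁ := Real.isLittleO_log_id_atTop.tendsto_div_nhds_zero.abs
    have h₂ := (tendsto_const_nhds (x := Real.pi)).div_atTop tendsto_id
    have h₃ := h₁.add h₂
    simp only [abs_zero, add_zero] at h₃
    refine h₃.congr' ?_
    filter_upwards [eventually_gt_atTop 0] with t ht
    simp only [id, abs_div, abs_of_pos ht]
    ring
  refine squeeze_zero_norm (fun x => ?_) (h.comp tendsto_norm_cobounded_atTop)
  rw [norm_div]
  simp only [Function.comp_apply]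
  gcongr
  calc ‖Complex.log x‖ ≤ |(Complex.log x).re| + |(Complex.log x).im| :=
        Complex.norm_le_abs_re_add_abs_im _
    _ ≤ |Real.log ‖x‖| + Real.pi := by
        rw [Complex.log_re, Complex.log_im]
        gcongr
        exact Complex.abs_arg_le_pi x

theorem const_mul_exp_mem_piAlpha (hR : Tendsto (fun x => R x / x ^ d) (cobounded ℂ) (𝓝 1))
    (ha₁ : a₁ ≠ 0) (hf : f = fun z => R z * Complex.exp (a₁ * z + a₀)) {k₀ : ℂ} (hk₀ : k₀ ≠ 0)
    {t : ℝ} (ht : 0 < t) :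
    (fun ζ => k₀ * Complex.exp (t * a₁ * ζ)) ∈ PiAlpha 0 f := by
  have ht0 : (t : ℂ) ≠ 0 := by exact_mod_cast ht.ne'
  have hn1 : ∀ n : ℕ, (n : ℂ) + 1 ≠ 0 := fun n => by exact_mod_cast n.succ_ne_zero
  set b : ℂ := 2 * Real.pi * Complex.I / a₁ with hb
  have hb0 : b ≠ 0 := div_ne_zero Complex.two_pi_I_ne_zero ha₁
  set x : ℕ → ℂ := fun n => ((n : ℂ) + 1) * b with hxdef
  have hx0 : ∀ n, x n ≠ 0 := fun n => mul_ne_zero (hn1 n) hb0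
  set h : ℕ → ℂ := fun n => (Complex.log (k₀ * Complex.exp (-a₀)) - d * Complex.log (x n)) / a₁
    with hh
  have hx : Tendsto (fun n => ‖x n‖) atTop atTop := by
    have h₁ : Tendsto (fun n : ℕ => ((n : ℝ) + 1) * ‖b‖) atTop atTop :=
      (tendsto_atTop_add_const_right _ 1 tendsto_natCast_atTop_atTop).atTop_mul_const
        (norm_pos_iff.2 hb0)
    refine h₁.congr fun n => ?_
    have : ‖(n : ℂ) + 1‖ = (n : ℝ) + 1 := by exact_mod_cast Complex.norm_natCast (n + 1)
    rw [hxdef, norm_mul, this]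
  have hhx : Tendsto (fun n => h n / x n) atTop (𝓝 0) := by
    have h₁ := tendsto_clog_div_self_cobounded.comp (tendsto_norm_atTop_iff_cobounded.1 hx)
    have h₂ := tendsto_div_zero_of_tendsto_norm_atTop hx
      (tendsto_const_nhds (x := Complex.log (k₀ * Complex.exp (-a₀))))
    have h₃ := (h₂.sub (h₁.const_mul (d : ℂ))).div_const a₁
    simp only [mul_zero, sub_zero, zero_div] at h₃
    refine h₃.congr fun n => ?_
    simp only [hh, Function.comp_apply]
    ring
  have hexp : ∀ n, Complex.exp (a₁ * (x n + h n) + a₀) = k₀ / x n ^ d := by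
    intro n
    have e : a₁ * (x n + h n) + a₀ = ((n + 1 : ℕ) : ℂ) * (2 * Real.pi * Complex.I) +
        (Complex.log (k₀ * Complex.exp (-a₀)) - d * Complex.log (x n)) + a₀ := by
      simp only [hxdef, hh, hb]
      push_cast
      field_simp
    rw [e, Complex.exp_add, Complex.exp_add, Complex.exp_nat_mul_two_pi_mul_I, Complex.exp_sub,
      Complex.exp_log (mul_ne_zero hk₀ (Complex.exp_ne_zero _)), Complex.exp_int_mul,
      Complex.exp_log (hx0 n), Complex.exp_neg]
    field_simp
  refine ⟨?_, ?_, b, fun n => n + 1, fun n => (x n + h n) / (n + 1), fun n => t / (n + 1),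
    tendsto_add_atTop_nat 1, ?_, fun n => by positivity, ?_, ?_⟩
  · intro ζ _
    exact AnalyticAt.meromorphicAt (by fun_prop)
  · intro c hc
    have h₀ := congrFun hc 0
    have h₁ := congrFun hc (1 / (t * a₁))
    rw [← h₀] at h₁
    have h₂ : (t : ℂ) * a₁ * (1 / (t * a₁)) = 1 := by field_simp
    simp only [h₂, mul_zero, Complex.exp_zero] at h₁
    exact cexp_one_ne_one (mul_left_cancel₀ hk₀ h₁)
  · have h₁ := (hhx.const_add 1).mul_const b
    rw [add_zero, one_mul] at h₁
    refine h₁.congr fun n => ?_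
    have := hn1 n
    simp only [hxdef]
    field_simp
  · simpa [Function.comp_def] using (tendsto_const_div_atTop_nhds_zero_nat t).comp (tendsto_add_atTop_nat 1)
  · have e : ∀ (n : ℕ) (ζ : ℂ), ((n + 1 : ℕ) : ℂ) * ((x n + h n) / (n + 1)) +
        ((n + 1 : ℕ) : ℂ) * ((t / (n + 1) : ℝ) : ℂ) * ζ = x n + (h n + t * ζ) := by
      intro n ζ
      have := hn1 n
      push_cast
      field_simp
      ring
    simp only [e, neg_zero, Real.rpow_zero, Complex.ofReal_one, one_mul]
    refine sphLocUnifConv_of_forall_tendsto (by fun_prop) fun ζ => ?_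
    have hX : Tendsto (fun y : ℕ × ℂ => ‖x y.1‖) (atTop ×ˢ 𝓝 ζ) atTop := hx.comp tendsto_fst
    have hH : Tendsto (fun y : ℕ × ℂ => (h y.1 + t * y.2) / x y.1) (atTop ×ˢ 𝓝 ζ) (𝓝 0) := by
      have h₁ : Tendsto (fun y : ℕ × ℂ => h y.1 / x y.1) (atTop ×ˢ 𝓝 ζ) (𝓝 0) :=
        hhx.comp tendsto_fst
      have h₂ : Tendsto (fun y : ℕ × ℂ => (t : ℂ) * y.2) (atTop ×ˢ 𝓝 ζ) (𝓝 (t * ζ)) :=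
        tendsto_snd.const_mul _
      simpa [add_div] using h₁.add (tendsto_div_zero_of_tendsto_norm_atTop hX h₂)
    have h₁ := tendsto_comp_add_div_zpow hR hX hH
    have hE : Continuous fun ζ : ℂ => k₀ * Complex.exp (t * a₁ * ζ) := by fun_prop
    have h₂ := h₁.mul ((hE.tendsto ζ).comp (tendsto_snd (f := atTop (α := ℕ))))
    rw [one_mul] at h₂
    refine h₂.congr fun y => ?_
    have e' : a₁ * (x y.1 + (h y.1 + t * y.2)) + a₀ =
        (a₁ * (x y.1 + h y.1) + a₀) + t * a₁ * y.2 := by ring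
    simp only [hf, e', Complex.exp_add _ ((t : ℂ) * a₁ * y.2), hexp, Function.comp_apply]
    ring

end Membership

/-- (Theorem 1, case `k = 1`, `α = 0`) For `f = R·e^{a₁z + a₀}` with
`a₁ ≠ 0`: `Π_0(f) = { ζ ↦ k₀·e^{A₁ζ} : k₀ ≠ 0, arg A₁ = arg a₁ } ∪
{ ζ ↦ f(C₁ + C₂ζ) : C₁ ∈ ℂ, C₂ > 0 real }`. -/
theorem piAlpha_zero_linear
    (m p : ℕ) (γ : Fin m → ℂ) (β : Fin p → ℂ)
    (hγ : Function.Injective γ) (hβ : Function.Injective β) (hγβ : ∀ i j, γ i ≠ β j)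
    (lm : Fin m → ℕ) (hlm : ∀ i, 1 ≤ lm i) (jp : Fin p → ℕ) (hjp : ∀ j, 1 ≤ jp j)
    (R : ℂ → ℂ) (hR : R = fun z => (∏ i, (z - γ i) ^ lm i) / ∏ j, (z - β j) ^ jp j)
    (a₁ a₀ : ℂ) (ha₁ : a₁ ≠ 0)
    (f : ℂ → ℂ) (hf : f = fun z => R z * Complex.exp (a₁ * z + a₀)) :
    PiAlpha 0 f =
      { g | (∃ k₀ A₁ : ℂ, k₀ ≠ 0 ∧ (∃ t : ℝ, 0 < t ∧ A₁ = (t : ℂ) * a₁) ∧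
              g = fun ζ => k₀ * Complex.exp (A₁ * ζ)) ∨
            (∃ (C₁ : ℂ) (C₂ : ℝ), 0 < C₂ ∧ g = fun ζ => f (C₁ + (C₂ : ℂ) * ζ)) } := by
  have hRinf := tendsto_factoredRational_div_zpow γ β lm jp
  have hRp : ∀ x, ContinuousAt R x ∨ (R x = 0 ∧ Tendsto (fun z => ‖R z‖) (𝓝[≠] x) atTop) := by
    rw [hR]
    exact continuousAt_or_pole_factoredRational γ β hγβ lm jp
  simp only [← funext_iff.1 hR] at hRinf
  have hRmer : Meromorphic R := by
    rw [hR]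
    intro x
    fun_prop
  have hfmer : Meromorphic f := by
    rw [hf]
    intro x
    exact (hRmer x).mul (AnalyticAt.meromorphicAt (by fun_prop))
  ext g
  constructor
  · rintro ⟨-, hne, z₀, k, z, ρ, -, -, hρ, -, hconv⟩
    simp only [neg_zero, Real.rpow_zero, Complex.ofReal_one, one_mul] at hconv
    exact eq_exp_or_affine_of_sphLocUnifConv (r := fun n => k n * ρ n) hRinf hRp ha₁ hf
      (fun n => mul_nonneg (Nat.cast_nonneg _) (hρ n).le) (by simpa using hconv) hne
  · rintro (⟨k₀, A₁, hk₀, ⟨t, ht, rfl⟩, rfl⟩ | ⟨C₁, C₂, hC₂, rfl⟩)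
    · exact const_mul_exp_mem_piAlpha hRinf ha₁ hf hk₀ ht
    · refine comp_affine_mem_piAlpha hfmer ?_ hC₂
      exact fun c => mul_exp_ne_const hRinf ha₁ hf c
end
end

section
/- Assume k = 1, that is, P(z) = a₁z + a₀ with a₁ ≠ 0, and let f = R·e^P as in the setup. Then for every real α with 0 < α < 1, Π_α(f) = { ζ ↦ k₀·e^{A₁ζ} : k₀ ∈ ℂ, k₀ ≠ 0, A₁ ∈ ℂ with arg A₁ = arg a₁ } ∪ { ζ ↦ e^{P(γ_i)}·R̃_{γ_i}(γ_i)·(A₁ζ + A₀)^{l_i} : 1 ≤ i ≤ m, A₀ ∈ ℂ, A₁ a real number with A₁ > 0 }. -/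
open Filter Topology Complex

noncomputable section

open Bornology

/-- The pointwise content of spherical convergence. -/
def SphTendsto {ι : Type*} (l : Filter ι) (F : ι → ℂ) (c : ℂ) : Prop :=
  Tendsto F l (𝓝 c) ∨ ((∀ᶠ n in l, F n ≠ 0) ∧ Tendsto (fun n => (F n)⁻¹) l (𝓝 c⁻¹))

section Spherical

variable {ι : Type*} {l : Filter ι} {F : ι → ℂ} {c : ℂ}

lemma SphLocUnifConv.sphTendsto {F : ℕ → ℂ → ℂ} {g : ℂ → ℂ} (h : SphLocUnifConv F g) (ζ : ℂ) :
    SphTendsto atTop (fun n => F n ζ) (g ζ) := by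
  obtain ⟨U, hU, h | ⟨hne, h⟩⟩ := h ζ
  · exact Or.inl (h.tendsto_at (mem_of_mem_nhds hU))
  · exact Or.inr ⟨hne.mono fun n hn => hn ζ (mem_of_mem_nhds hU),
      h.tendsto_at (mem_of_mem_nhds hU)⟩

lemma SphTendsto.mono {l' : Filter ι} (h : SphTendsto l F c) (hl : l' ≤ l) :
    SphTendsto l' F c :=
  h.imp (fun h => h.mono_left hl) fun h => ⟨h.1.filter_mono hl, h.2.mono_left hl⟩

lemma SphTendsto.tendsto (h : SphTendsto l F c) (hc : c ≠ 0) : Tendsto F l (𝓝 c) := by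
  rcases h with h | ⟨-, h⟩
  · exact h
  · simpa using h.inv₀ (inv_ne_zero hc)

lemma SphTendsto.eq_of_tendsto [l.NeBot] {d : ℂ} (h : SphTendsto l F c)
    (hF : Tendsto F l (𝓝 d)) : c = d := by
  rcases h with h | ⟨hne, h⟩
  · exact tendsto_nhds_unique h hF
  · have h1 : Tendsto (fun n => F n * (F n)⁻¹) l (𝓝 (d * c⁻¹)) := hF.mul h
    have h2 : Tendsto (fun n => F n * (F n)⁻¹) l (𝓝 1) :=
      tendsto_const_nhds.congr' (hne.mono fun n hn => (mul_inv_cancel₀ hn).symm)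
    have h3 := tendsto_nhds_unique h1 h2
    have hc : c ≠ 0 := by rintro rfl; simp at h3
    field_simp at h3
    exact h3.symm

/-- A uniform limit near `x` of functions continuous at `x` is continuous at `x`. -/
lemma TendstoUniformlyOn.continuousAt_of_eventually {F : ℕ → ℂ → ℂ} {g : ℂ → ℂ} {U : Set ℂ}
    {x : ℂ} (h : TendstoUniformlyOn F g atTop U) (hU : U ∈ 𝓝 x)
    (hF : ∀ᶠ n in atTop, ContinuousAt (F n) x) : ContinuousAt g x := by
  refine continuousAt_of_locally_uniform_approx_of_continuousAt fun u hu => ?_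
  obtain ⟨n, hn, hc⟩ := ((h u hu).and hF).exists
  exact ⟨U, hU, F n, hc, hn⟩

/-- A spherical limit is continuous and finite where it does not vanish, if the approximants are
continuous where they do not vanish. -/
lemma SphLocUnifConv.continuousAt {F : ℕ → ℂ → ℂ} {g : ℂ → ℂ} (h : SphLocUnifConv F g)
    (hF : ∀ n x, F n x ≠ 0 → ContinuousAt (F n) x) {x : ℂ} (hx : g x ≠ 0) :
    ContinuousAt g x := by
  have hev := ((h.sphTendsto x).tendsto hx).eventually_ne hx
  obtain ⟨U, hU, h | ⟨-, h⟩⟩ := h x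
  · exact h.continuousAt_of_eventually hU (hev.mono fun n hn => hF n x hn)
  · have := (h.continuousAt_of_eventually hU
      (hev.mono fun n hn => (hF n x hn).inv₀ hn)).inv₀ (inv_ne_zero hx)
    exact this.congr (Eventually.of_forall fun w => inv_inv (g w))

/-- Continuous convergence to a continuous limit implies spherical locally uniform convergence. -/
lemma SphLocUnifConv.of_tendsto {F : ℕ → ℂ → ℂ} {g : ℂ → ℂ} (hg : Continuous g)
    (h : ∀ ζ, Tendsto (fun q : ℕ × ℂ => F q.1 q.2) (atTop ×ˢ 𝓝 ζ) (𝓝 (g ζ))) :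
    SphLocUnifConv F g := by
  have hl : TendstoLocallyUniformly F g atTop := by
    refine tendstoLocallyUniformly_iff_forall_tendsto.2 fun ζ => ?_
    have h1 : Tendsto (fun q : ℕ × ℂ => (g q.2, F q.1 q.2)) (atTop ×ˢ 𝓝 ζ)
        (𝓝 (g ζ, g ζ)) := ((hg.tendsto ζ).comp tendsto_snd).prodMk_nhds (h ζ)
    exact h1.mono_right (nhds_le_uniformity _)
  intro z₀
  refine ⟨Metric.closedBall z₀ 1, Metric.closedBall_mem_nhds _ one_pos, Or.inl ?_⟩
  exact (tendstoLocallyUniformlyOn_iff_tendstoUniformlyOn_of_compact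
    (isCompact_closedBall z₀ 1)).1 hl.tendstoLocallyUniformlyOn

/-- If `F n ζ = d n * G n ζ` with `G` convergent, a spherical limit of `F` that is nonzero at one
point is a nonzero multiple of the limit of `G`. -/
lemma eq_mul_of_sphTendsto [l.NeBot] {F G : ι → ℂ → ℂ} {d : ι → ℂ} {g E : ℂ → ℂ}
    (hF : ∀ ζ, SphTendsto l (fun n => F n ζ) (g ζ))
    (hFG : ∀ᶠ n in l, ∀ ζ, F n ζ = d n * G n ζ)
    (hG : ∀ ζ, Tendsto (fun n => G n ζ) l (𝓝 (E ζ))) {ζ₁ : ℂ} (hg : g ζ₁ ≠ 0) (hE : E ζ₁ ≠ 0) :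
    ∃ k, k ≠ 0 ∧ Tendsto d l (𝓝 k) ∧ ∀ ζ, g ζ = k * E ζ := by
  have hd : Tendsto d l (𝓝 (g ζ₁ / E ζ₁)) := by
    refine (((hF ζ₁).tendsto hg).div (hG ζ₁) hE).congr' ?_
    filter_upwards [hFG, (hG ζ₁).eventually_ne hE] with n hn hne
    simp only [Pi.div_apply, hn]
    field_simp
  refine ⟨g ζ₁ / E ζ₁, div_ne_zero hg hE, hd, fun ζ => (hF ζ).eq_of_tendsto ?_⟩
  exact (hd.mul (hG ζ)).congr' (hFG.mono fun n hn => (hn ζ).symm)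

lemma Ultrafilter.tendsto_nhds_or_cobounded (l : Ultrafilter ι) (u : ι → ℂ) :
    (∃ x, Tendsto u l (𝓝 x)) ∨ Tendsto u l (cobounded ℂ) := by
  by_cases h : ∃ K : Set ℂ, IsCompact K ∧ K ∈ l.map u
  · obtain ⟨K, hK, hKl⟩ := h
    obtain ⟨x, -, hx⟩ := hK.ultrafilter_le_nhds' _ hKl
    exact Or.inl ⟨x, hx⟩
  · right
    rw [Metric.cobounded_eq_cocompact]
    refine (hasBasis_cocompact.tendsto_right_iff).2 fun K hK => ?_
    have : K ∉ l.map u := fun hKl => h ⟨K, hK, hKl⟩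
    exact Ultrafilter.compl_mem_iff_notMem.2 this

end Spherical

section Rational

/-- The rational function with zeros `γ`, poles `β` and multiplicities `lm`, `jp`. -/
def ratFun {m p : ℕ} (γ : Fin m → ℂ) (β : Fin p → ℂ) (lm : Fin m → ℕ) (jp : Fin p → ℕ)
    (z : ℂ) : ℂ :=
  (∏ i, (z - γ i) ^ lm i) / ∏ j, (z - β j) ^ jp j

variable {m p : ℕ} {γ : Fin m → ℂ} {β : Fin p → ℂ} {lm : Fin m → ℕ} {jp : Fin p → ℕ}
variable {ι : Type*} {l : Filter ι} {x y : ι → ℂ}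

lemma ratFun_ne_zero {z : ℂ} (h₁ : ∀ i, z ≠ γ i) (h₂ : ∀ j, z ≠ β j) :
    ratFun γ β lm jp z ≠ 0 :=
  div_ne_zero (Finset.prod_ne_zero_iff.2 fun i _ => pow_ne_zero _ (sub_ne_zero.2 (h₁ i)))
    (Finset.prod_ne_zero_iff.2 fun j _ => pow_ne_zero _ (sub_ne_zero.2 (h₂ j)))

lemma inv_ratFun (z : ℂ) : (ratFun γ β lm jp z)⁻¹ = ratFun β γ jp lm z := inv_div _ _

lemma continuousAt_ratFun {z : ℂ} (h : ∏ j, (z - β j) ^ jp j ≠ 0) :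
    ContinuousAt (ratFun γ β lm jp) z := by
  unfold ratFun
  exact ContinuousAt.div (by fun_prop) (by fun_prop) h

lemma tendsto_ratFun_div {r : ℂ} (hr : r ≠ 0)
    (h : ∀ c, Tendsto (fun n => (y n - c) / (x n - c)) l (𝓝 r)) :
    Tendsto (fun n => ratFun γ β lm jp (y n) / ratFun γ β lm jp (x n)) l
      (𝓝 ((∏ i, r ^ lm i) / ∏ j, r ^ jp j)) := by
  have h1 : Tendsto (fun n => (∏ i, ((y n - γ i) / (x n - γ i)) ^ lm i) /
      ∏ j, ((y n - β j) / (x n - β j)) ^ jp j) l (𝓝 ((∏ i, r ^ lm i) / ∏ j, r ^ jp j)) :=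
    (tendsto_finsetProd _ fun i _ => (h (γ i)).pow _).div
      (tendsto_finsetProd _ fun i _ => (h (β i)).pow _)
      (Finset.prod_ne_zero_iff.2 fun j _ => pow_ne_zero _ hr)
  refine h1.congr fun n => ?_
  simp only [ratFun, div_pow, Finset.prod_div_distrib, div_div_div_comm]

lemma tendsto_sub_div_sub (hx : Tendsto x l (cobounded ℂ))
    (hy : Tendsto (fun n => y n / x n) l (𝓝 1)) (c : ℂ) :
    Tendsto (fun n => (y n - c) / (x n - c)) l (𝓝 1) := by
  have h0 : Tendsto (fun n => c * (x n)⁻¹) l (𝓝 0) := by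
    simpa using (tendsto_inv₀_cobounded.comp hx).const_mul c
  have h1 : Tendsto (fun n => (y n / x n - c * (x n)⁻¹) / (1 - c * (x n)⁻¹)) l (𝓝 1) := by
    simpa [Pi.div_def] using (hy.sub h0).div ((tendsto_const_nhds (x := (1 : ℂ))).sub h0) (by simp)
  refine h1.congr' ?_
  filter_upwards [hx.eventually_ne_cobounded 0] with n hn
  rw [← mul_div_mul_right _ _ hn]
  congr 1 <;> field_simp

/-- `R (y n) / R (x n) → 1` when `x n → ∞` and `y n / x n → 1`. -/
lemma tendsto_ratFun_div_one (hx : Tendsto x l (cobounded ℂ))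
    (hy : Tendsto (fun n => y n / x n) l (𝓝 1)) :
    Tendsto (fun n => ratFun γ β lm jp (y n) / ratFun γ β lm jp (x n)) l (𝓝 1) := by
  simpa using tendsto_ratFun_div (γ := γ) (β := β) (lm := lm) (jp := jp) one_ne_zero
    (tendsto_sub_div_sub hx hy)

lemma eventually_ratFun_ne_zero (hx : Tendsto x l (cobounded ℂ)) :
    ∀ᶠ n in l, ratFun γ β lm jp (x n) ≠ 0 := by
  filter_upwards [eventually_all.2 fun i => hx.eventually_ne_cobounded (γ i),
    eventually_all.2 fun j => hx.eventually_ne_cobounded (β j)] with n h₁ h₂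
  exact ratFun_ne_zero h₁ h₂

/-- The cofactor of `(z - γ i) ^ lm i` in `ratFun`. -/
def ratCofactor {m p : ℕ} (γ : Fin m → ℂ) (β : Fin p → ℂ) (lm : Fin m → ℕ) (jp : Fin p → ℕ)
    (i : Fin m) (z : ℂ) : ℂ :=
  (∏ j ∈ Finset.univ.erase i, (z - γ j) ^ lm j) / ∏ j, (z - β j) ^ jp j

lemma ratFun_eq_mul_ratCofactor (i : Fin m) (z : ℂ) :
    ratFun γ β lm jp z = (z - γ i) ^ lm i * ratCofactor γ β lm jp i z := by
  rw [ratFun, ratCofactor, ← Finset.mul_prod_erase Finset.univ _ (Finset.mem_univ i), mul_div_assoc]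

lemma ratCofactor_ne_zero (hγ : Function.Injective γ) (hγβ : ∀ i j, γ i ≠ β j) (i : Fin m) :
    ratCofactor γ β lm jp i (γ i) ≠ 0 :=
  div_ne_zero
    (Finset.prod_ne_zero_iff.2 fun _ hj =>
      pow_ne_zero _ (sub_ne_zero.2 (hγ.ne (Finset.ne_of_mem_erase hj).symm)))
    (Finset.prod_ne_zero_iff.2 fun j _ => pow_ne_zero _ (sub_ne_zero.2 (hγβ i j)))

lemma continuousAt_ratCofactor (hγβ : ∀ i j, γ i ≠ β j) (i : Fin m) :
    ContinuousAt (ratCofactor γ β lm jp i) (γ i) := by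
  unfold ratCofactor
  exact ContinuousAt.div (by fun_prop) (by fun_prop)
    (Finset.prod_ne_zero_iff.2 fun j _ => pow_ne_zero _ (sub_ne_zero.2 (hγβ i j)))

end Rational

section Limits

variable {m p : ℕ} {γ : Fin m → ℂ} {β : Fin p → ℂ} {lm : Fin m → ℕ} {jp : Fin p → ℕ}
variable {a₁ a₀ : ℂ} {ι : Type*} {c s : ι → ℝ} {w : ι → ℂ} {g : ℂ → ℂ}

lemma tendsto_add_mul_const {l : Filter ι} {w₀ : ℂ} {s₀ : ℝ} (hw : Tendsto w l (𝓝 w₀))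
    (hs : Tendsto s l (𝓝 s₀)) (ζ : ℂ) :
    Tendsto (fun n => w n + (s n : ℂ) * ζ) l (𝓝 (w₀ + (s₀ : ℂ) * ζ)) :=
  hw.add (((continuous_ofReal.tendsto s₀).comp hs).mul_const ζ)

/-- A nonempty open set contains two points at which the real parts of `a₁ * ζ` differ. -/
lemma exists_re_mul_sub_pos (ha₁ : a₁ ≠ 0) {V : Set ℂ} (hV : IsOpen V) (hVne : V.Nonempty) :
    ∃ ζ ∈ V, ∃ ζ' ∈ V, 0 < (a₁ * (ζ - ζ')).re := by
  obtain ⟨ζ', hζ'⟩ := hVne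
  have h1 : Tendsto (fun ε : ℝ => ζ' + (ε : ℂ) * (starRingEnd ℂ) a₁) (𝓝[>] 0) (𝓝 ζ') := by
    have : Continuous fun ε : ℝ => ζ' + (ε : ℂ) * (starRingEnd ℂ) a₁ := by fun_prop
    simpa using (this.tendsto 0).mono_left nhdsWithin_le_nhds
  obtain ⟨ε, hε, hε0⟩ :=
    ((h1.eventually (hV.mem_nhds hζ')).and self_mem_nhdsWithin).exists
  refine ⟨_, hε, ζ', hζ', ?_⟩
  have : a₁ * (ζ' + (ε : ℂ) * (starRingEnd ℂ) a₁ - ζ') = ((ε * normSq a₁ : ℝ) : ℂ) := by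
    push_cast
    rw [normSq_eq_conj_mul_self]
    ring
  rw [this, ofReal_re]
  exact mul_pos hε0 (normSq_pos.2 ha₁)

/-- The scales `s n` cannot tend to infinity. -/
lemma not_tendsto_scale_atTop (ha₁ : a₁ ≠ 0) (l : Ultrafilter ι) (hc : Tendsto c l atTop)
    {V : Set ℂ} (hV : IsOpen V) (hVne : V.Nonempty) (hgV : ∀ ζ ∈ V, g ζ ≠ 0)
    (hF : ∀ ζ, SphTendsto l (fun n => (c n : ℂ) * (ratFun γ β lm jp (w n + (s n : ℂ) * ζ) *
      exp (a₁ * (w n + (s n : ℂ) * ζ) + a₀))) (g ζ)) :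
    ¬ Tendsto s l atTop := by
  intro hs
  have hsC : Tendsto (fun n => (s n : ℂ)) l (cobounded ℂ) :=
    tendsto_norm_atTop_iff_cobounded.1 (by simpa [Function.comp_def] using tendsto_abs_atTop_atTop.comp hs)
  have hs0 : ∀ᶠ n in (l : Filter ι), (s n : ℂ) ≠ 0 := hsC.eventually_ne_cobounded 0
  obtain ⟨V', hV', hV'ne, hV'V, hr⟩ : ∃ V' : Set ℂ, IsOpen V' ∧ V'.Nonempty ∧ V' ⊆ V ∧
      ∀ ζ ∈ V', ∀ ζ' ∈ V', ∃ r : ℂ, r ≠ 0 ∧ ∀ b : ℂ, Tendsto (fun n =>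
        ((w n + (s n : ℂ) * ζ) - b) / ((w n + (s n : ℂ) * ζ') - b)) l (𝓝 r) := by
    rcases l.tendsto_nhds_or_cobounded (fun n => w n / s n) with ⟨q, hq⟩ | hq
    · refine ⟨V ∩ {-q}ᶜ, hV.inter isOpen_compl_singleton, ?_, Set.inter_subset_left, ?_⟩
      · exact (dense_compl_singleton (-q)).inter_open_nonempty V hV hVne
      · rintro ζ ⟨-, hζ⟩ ζ' ⟨-, hζ'⟩
        have hne : ∀ ζ : ℂ, ζ ∈ ({-q} : Set ℂ)ᶜ → q + ζ ≠ 0 := fun ζ h h0 =>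
          h (by simp [eq_neg_of_add_eq_zero_right h0])
        refine ⟨(q + ζ) / (q + ζ'), div_ne_zero (hne _ hζ) (hne _ hζ'), fun b => ?_⟩
        have hb : Tendsto (fun n => b * (s n : ℂ)⁻¹) l (𝓝 0) := by
          simpa using (tendsto_inv₀_cobounded.comp hsC).const_mul b
        have hlim : ∀ ζ, Tendsto (fun n => w n / s n + ζ - b * (s n : ℂ)⁻¹) l (𝓝 (q + ζ)) :=
          fun ζ => by simpa using (hq.add_const ζ).sub hb
        refine ((hlim ζ).div (hlim ζ') (hne _ hζ')).congr' ?_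
        filter_upwards [hs0] with n hn
        simp only [Pi.div_apply]
        rw [← mul_div_mul_right _ _ hn]
        congr 1 <;> field_simp
    · refine ⟨V, hV, hVne, subset_rfl, fun ζ _ ζ' _ => ⟨1, one_ne_zero, ?_⟩⟩
      have hx : ∀ ζ, Tendsto (fun n => w n / s n + ζ) l (cobounded ℂ) := fun ζ =>
        (tendsto_add_const_cobounded ζ).comp hq
      have hxs : Tendsto (fun n => w n + (s n : ℂ) * ζ') l (cobounded ℂ) := by
        rw [← tendsto_norm_atTop_iff_cobounded]
        have h1 := (tendsto_norm_atTop_iff_cobounded.2 (hx ζ')).atTop_mul_atTop₀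
          (tendsto_norm_atTop_iff_cobounded.2 hsC)
        refine h1.congr' ?_
        filter_upwards [hs0] with n hn
        rw [← norm_mul]
        congr 1
        field_simp
      refine tendsto_sub_div_sub hxs ?_
      have h2 : Tendsto (fun n => 1 + (ζ - ζ') * (w n / s n + ζ')⁻¹) l (𝓝 1) := by
        simpa using ((tendsto_inv₀_cobounded.comp (hx ζ')).const_mul (ζ - ζ')).const_add 1
      refine h2.congr' ?_
      filter_upwards [hs0, (hx ζ').eventually_ne_cobounded 0] with n hn hn'
      have h3 : w n + (s n : ℂ) * ζ' = s n * (w n / s n + ζ') := by field_simp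
      have h4 : w n + (s n : ℂ) * ζ = s n * ((w n / s n + ζ') + (ζ - ζ')) := by field_simp; ring
      rw [h3, h4, mul_div_mul_left _ _ hn, add_div, div_self hn', div_eq_mul_inv (ζ - ζ')]
  obtain ⟨ζ, hζ, ζ', hζ', hre⟩ := exists_re_mul_sub_pos ha₁ hV' hV'ne
  obtain ⟨r, hr0, hr⟩ := hr ζ hζ ζ' hζ'
  have hR := tendsto_ratFun_div (γ := γ) (β := β) (lm := lm) (jp := jp) hr0 hr
  have hlim0 : (∏ i, r ^ lm i) / ∏ j, r ^ jp j ≠ 0 :=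
    div_ne_zero (Finset.prod_ne_zero_iff.2 fun _ _ => pow_ne_zero _ hr0)
      (Finset.prod_ne_zero_iff.2 fun _ _ => pow_ne_zero _ hr0)
  have hg' := hgV ζ' (hV'V hζ')
  have hquot := (((hF ζ).tendsto (hgV ζ (hV'V hζ))).div ((hF ζ').tendsto hg') hg').div hR hlim0
  have hexp : Tendsto (fun n => exp (a₁ * (ζ - ζ') * s n)) l
      (𝓝 (g ζ / g ζ' / ((∏ i, r ^ lm i) / ∏ j, r ^ jp j))) := by
    refine hquot.congr' ?_
    filter_upwards [hR.eventually_ne hlim0, hc.eventually_gt_atTop 0] with n hn hcn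
    have hcn' : (c n : ℂ) ≠ 0 := by exact_mod_cast hcn.ne'
    have h1 := (div_ne_zero_iff.1 hn).1
    have h2 := (div_ne_zero_iff.1 hn).2
    simp only [Pi.div_apply]
    have h3 : exp (a₁ * (w n + (s n : ℂ) * ζ) + a₀) =
        exp (a₁ * (ζ - ζ') * s n) * exp (a₁ * (w n + (s n : ℂ) * ζ') + a₀) := by
      rw [← Complex.exp_add]; congr 1; ring
    rw [h3]
    have h4 := exp_ne_zero (a₁ * (w n + (s n : ℂ) * ζ') + a₀)
    generalize exp (a₁ * (w n + (s n : ℂ) * ζ') + a₀) = e at *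
    generalize ratFun γ β lm jp (w n + (s n : ℂ) * ζ) = A at *
    generalize ratFun γ β lm jp (w n + (s n : ℂ) * ζ') = B at *
    field_simp
  have hnorm : Tendsto (fun n => ‖exp (a₁ * (ζ - ζ') * s n)‖) l atTop := by
    simp only [norm_exp, re_mul_ofReal]
    exact Real.tendsto_exp_atTop.comp (hs.const_mul_atTop hre)
  exact not_tendsto_nhds_of_tendsto_atTop hnorm _ hexp.norm

/-- Limits along `w n → ∞` with bounded scales are exponentials. -/
lemma eq_exp_of_tendsto_cobounded {l : Filter ι} [l.NeBot]
    {s₀ : ℝ} (hw : Tendsto w l (cobounded ℂ)) (hs : Tendsto s l (𝓝 s₀)) {ζ₁ : ℂ} (hg : g ζ₁ ≠ 0)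
    (hF : ∀ ζ, SphTendsto l (fun n => (c n : ℂ) * (ratFun γ β lm jp (w n + (s n : ℂ) * ζ) *
      exp (a₁ * (w n + (s n : ℂ) * ζ) + a₀))) (g ζ)) :
    ∃ k, k ≠ 0 ∧ ∀ ζ, g ζ = k * exp (s₀ * a₁ * ζ) := by
  have hsC : Tendsto (fun n => (s n : ℂ)) l (𝓝 s₀) := (continuous_ofReal.tendsto s₀).comp hs
  have hG : ∀ ζ, Tendsto (fun n => ratFun γ β lm jp (w n + (s n : ℂ) * ζ) /
      ratFun γ β lm jp (w n) * exp (s n * a₁ * ζ)) l (𝓝 (exp (s₀ * a₁ * ζ))) := by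
    intro ζ
    have h1 : Tendsto (fun n => (w n + (s n : ℂ) * ζ) / w n) l (𝓝 1) := by
      have h2 : Tendsto (fun n => 1 + (s n : ℂ) * ζ * (w n)⁻¹) l (𝓝 1) := by
        simpa using ((hsC.mul_const ζ).mul (tendsto_inv₀_cobounded.comp hw)).const_add 1
      refine h2.congr' ?_
      filter_upwards [hw.eventually_ne_cobounded 0] with n hn
      field_simp
    simpa using (tendsto_ratFun_div_one hw h1).mul
      ((continuous_exp.tendsto _).comp ((hsC.mul_const a₁).mul_const ζ))
  have hFG : ∀ᶠ n in l, ∀ ζ, (c n : ℂ) * (ratFun γ β lm jp (w n + (s n : ℂ) * ζ) *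
      exp (a₁ * (w n + (s n : ℂ) * ζ) + a₀)) =
      (c n : ℂ) * (ratFun γ β lm jp (w n) * exp (a₁ * w n + a₀)) *
        (ratFun γ β lm jp (w n + (s n : ℂ) * ζ) / ratFun γ β lm jp (w n) *
          exp (s n * a₁ * ζ)) := by
    filter_upwards [eventually_ratFun_ne_zero (γ := γ) (β := β) (lm := lm) (jp := jp) hw]
      with n hn ζ
    have h3 : exp (a₁ * (w n + (s n : ℂ) * ζ) + a₀) =
        exp (a₁ * w n + a₀) * exp (s n * a₁ * ζ) := by
      rw [← Complex.exp_add]; congr 1; ring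
    rw [h3]
    field_simp
  obtain ⟨k, hk, -, h⟩ := eq_mul_of_sphTendsto hF hFG hG hg (exp_ne_zero _)
  exact ⟨k, hk, h⟩

/-- If `w n` and `s n` converge, the limiting points are zeros of `R`. -/
lemma exists_eq_zero_of_tendsto {l : Filter ι} [l.NeBot] (hc : Tendsto c l atTop) {w₀ : ℂ} {s₀ : ℝ}
    (hw : Tendsto w l (𝓝 w₀)) (hs : Tendsto s l (𝓝 s₀)) {ζ : ℂ} (hg : g ζ ≠ 0)
    (hF : SphTendsto l (fun n => (c n : ℂ) * (ratFun γ β lm jp (w n + (s n : ℂ) * ζ) *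
      exp (a₁ * (w n + (s n : ℂ) * ζ) + a₀))) (g ζ)) :
    ∃ i, w₀ + (s₀ : ℂ) * ζ = γ i := by
  by_contra! hne
  have hu := tendsto_add_mul_const hw hs ζ
  have hinv := (hF.tendsto hg).inv₀ hg
  have hcont : ContinuousAt (fun z => ratFun β γ jp lm z * exp (-(a₁ * z + a₀)))
      (w₀ + (s₀ : ℂ) * ζ) :=
    (continuousAt_ratFun (Finset.prod_ne_zero_iff.2 fun i _ =>
      pow_ne_zero _ (sub_ne_zero.2 (hne i)))).mul (by fun_prop)
  have hc0 : Tendsto (fun n => ((c n)⁻¹ : ℂ)) l (𝓝 0) := by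
    simpa [Function.comp_def] using
      (continuous_ofReal.tendsto 0).comp (tendsto_inv_atTop_zero.comp hc)
  have h0 := hc0.mul (hcont.tendsto.comp hu)
  rw [zero_mul] at h0
  refine inv_ne_zero hg (tendsto_nhds_unique hinv (h0.congr fun n => ?_))
  simp only [Function.comp_apply, mul_inv, inv_ratFun, Complex.exp_neg]

/-- Limits along `w n → γ i` with scales tending to zero are powers of affine functions. -/
lemma eq_pow_of_tendsto_zero (hγ : Function.Injective γ) (hγβ : ∀ i j, γ i ≠ β j) {i : Fin m}
    (hlm : 1 ≤ lm i) (l : Ultrafilter ι) (hs : ∀ᶠ n in (l : Filter ι), 0 < s n)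
    (hc : Tendsto c l atTop)
    (hw : Tendsto w l (𝓝 (γ i))) (hs0 : Tendsto s l (𝓝 0)) (hnc : ∀ b : ℂ, g ≠ fun _ => b)
    {V : Set ℂ} (hV : IsOpen V) (hVne : V.Nonempty) (hgV : ∀ ζ ∈ V, g ζ ≠ 0)
    (hF : ∀ ζ, SphTendsto l (fun n => (c n : ℂ) * (ratFun γ β lm jp (w n + (s n : ℂ) * ζ) *
      exp (a₁ * (w n + (s n : ℂ) * ζ) + a₀))) (g ζ)) :
    ∃ (A₀ : ℂ) (A₁ : ℝ), 0 < A₁ ∧ g = fun ζ => exp (a₁ * γ i + a₀) *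
      ratCofactor γ β lm jp i (γ i) * ((A₁ : ℂ) * ζ + A₀) ^ lm i := by
  set C := exp (a₁ * γ i + a₀) * ratCofactor γ β lm jp i (γ i)
  have hC0 : C ≠ 0 := mul_ne_zero (exp_ne_zero _) (ratCofactor_ne_zero hγ hγβ i)
  have hH : ∀ ζ, Tendsto (fun n => exp (a₁ * (w n + (s n : ℂ) * ζ) + a₀) *
      ratCofactor γ β lm jp i (w n + (s n : ℂ) * ζ)) l (𝓝 C) := by
    intro ζ
    have hcont : ContinuousAt (fun z => exp (a₁ * z + a₀) * ratCofactor γ β lm jp i z) (γ i) :=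
      ContinuousAt.mul (by fun_prop) (continuousAt_ratCofactor hγβ i)
    have hu : Tendsto (fun n => w n + (s n : ℂ) * ζ) l (𝓝 (γ i)) := by
      simpa using tendsto_add_mul_const hw hs0 ζ
    exact hcont.tendsto.comp hu
  rcases l.tendsto_nhds_or_cobounded (fun n => (w n - γ i) / s n) with ⟨q, hq⟩ | hq
  · obtain ⟨ζ₁, hζ₁V, hζ₁⟩ := (dense_compl_singleton (-q)).inter_open_nonempty V hV hVne
    have hζ₁' : ζ₁ + q ≠ 0 := fun h => hζ₁ (by simp [eq_neg_of_add_eq_zero_left h])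
    have hFG : ∀ᶠ n in (l : Filter ι), ∀ ζ, (c n : ℂ) * (ratFun γ β lm jp (w n + (s n : ℂ) * ζ) *
        exp (a₁ * (w n + (s n : ℂ) * ζ) + a₀)) =
        ((c n * s n ^ lm i : ℝ) : ℂ) * ((ζ + (w n - γ i) / s n) ^ lm i *
        (exp (a₁ * (w n + (s n : ℂ) * ζ) + a₀) *
          ratCofactor γ β lm jp i (w n + (s n : ℂ) * ζ))) := by
      filter_upwards [hs] with n hn ζ
      have hn' : (s n : ℂ) ≠ 0 := by exact_mod_cast hn.ne'
      rw [ratFun_eq_mul_ratCofactor i]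
      have : w n + (s n : ℂ) * ζ - γ i = s n * (ζ + (w n - γ i) / s n) := by
        field_simp; ring
      rw [this, mul_pow]
      push_cast
      ring
    obtain ⟨k, hk, hd, h⟩ := eq_mul_of_sphTendsto hF hFG
      (fun ζ => ((hq.const_add ζ).pow _).mul (hH ζ)) (hgV _ hζ₁V)
      (mul_ne_zero (pow_ne_zero _ hζ₁') hC0)
    obtain ⟨t, ht, rfl⟩ : ∃ t : ℝ, 0 ≤ t ∧ (t : ℂ) = k := by
      have hcl : IsClosed ((fun t : ℝ => (t : ℂ)) '' Set.Ici 0) :=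
        Complex.isometry_ofReal.isClosedEmbedding.isClosedMap _ isClosed_Ici
      refine hcl.mem_of_tendsto hd ?_
      filter_upwards [hc.eventually_ge_atTop 0, hs] with n hn hsn
      exact ⟨_, mul_nonneg hn (pow_nonneg hsn.le _), rfl⟩
    have ht' : 0 < t := lt_of_le_of_ne ht fun h => hk (by simp [← h])
    set A := t ^ ((lm i : ℝ)⁻¹)
    have hApow : A ^ lm i = t := Real.rpow_inv_natCast_pow ht (by omega)
    refine ⟨A * q, A, Real.rpow_pos_of_pos ht' _, funext fun ζ => ?_⟩
    rw [h ζ, ← mul_add, mul_pow, ← ofReal_pow, hApow]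
    ring
  · exfalso
    obtain ⟨ζ₁, hζ₁⟩ := hVne
    have hq1 : ∀ ζ : ℂ, Tendsto (fun n => (1 + ζ * ((w n - γ i) / s n)⁻¹) ^ lm i) l (𝓝 1) := by
      intro ζ
      simpa using (((tendsto_inv₀_cobounded.comp hq).const_mul ζ).const_add 1).pow (lm i)
    have hFG : ∀ᶠ n in (l : Filter ι), ∀ ζ, (c n : ℂ) * (ratFun γ β lm jp (w n + (s n : ℂ) * ζ) *
        exp (a₁ * (w n + (s n : ℂ) * ζ) + a₀)) =
        ((c n : ℂ) * (w n - γ i) ^ lm i) * ((1 + ζ * ((w n - γ i) / s n)⁻¹) ^ lm i *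
        (exp (a₁ * (w n + (s n : ℂ) * ζ) + a₀) *
          ratCofactor γ β lm jp i (w n + (s n : ℂ) * ζ))) := by
      filter_upwards [hq.eventually_ne_cobounded 0] with n hn ζ
      have h1 := (div_ne_zero_iff.1 hn).1
      have h2 := (div_ne_zero_iff.1 hn).2
      rw [ratFun_eq_mul_ratCofactor i]
      have : w n + (s n : ℂ) * ζ - γ i = (w n - γ i) * (1 + ζ * ((w n - γ i) / s n)⁻¹) := by
        field_simp; ring
      rw [this, mul_pow]
      ring
    obtain ⟨k, -, -, h⟩ := eq_mul_of_sphTendsto hF hFG (E := fun _ => 1 * C)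
      (fun ζ => (hq1 ζ).mul (hH ζ)) (hgV _ hζ₁) (by simpa using hC0)
    exact hnc _ (funext h)

end Limits

section Classification

variable {m p : ℕ} {γ : Fin m → ℂ} {β : Fin p → ℂ} {lm : Fin m → ℕ} {jp : Fin p → ℕ}
variable {a₁ a₀ : ℂ} {α : ℝ}

/-- Every element of `Π_α(R e^P)` has one of the two listed forms. -/
lemma eq_exp_or_eq_pow_of_mem_piAlpha (hγ : Function.Injective γ) (hγβ : ∀ i j, γ i ≠ β j)
    (hlm : ∀ i, 1 ≤ lm i) (ha₁ : a₁ ≠ 0) (hα : 0 < α) {g : ℂ → ℂ}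
    (hg : g ∈ PiAlpha α fun z => ratFun γ β lm jp z * exp (a₁ * z + a₀)) :
    (∃ k₀ A₁ : ℂ, k₀ ≠ 0 ∧ (∃ t : ℝ, 0 < t ∧ A₁ = (t : ℂ) * a₁) ∧
        g = fun ζ => k₀ * exp (A₁ * ζ)) ∨
      ∃ (i : Fin m) (A₀ : ℂ) (A₁ : ℝ), 0 < A₁ ∧ g = fun ζ => exp (a₁ * γ i + a₀) *
        ratCofactor γ β lm jp i (γ i) * ((A₁ : ℂ) * ζ + A₀) ^ lm i := by
  obtain ⟨-, hnc, z₀, k, z, ρ, hk, -, hρpos, hρ, hconv⟩ := hg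
  set c : ℕ → ℝ := fun n => ρ n ^ (-α)
  set w : ℕ → ℂ := fun n => (k n : ℂ) * z n
  set s : ℕ → ℝ := fun n => k n * ρ n
  have hconv' : SphLocUnifConv (fun n ζ => (c n : ℂ) *
      (ratFun γ β lm jp (w n + (s n : ℂ) * ζ) * exp (a₁ * (w n + (s n : ℂ) * ζ) + a₀))) g := by
    simpa [c, w, s] using hconv
  have hc : Tendsto c atTop atTop :=
    (tendsto_rpow_neg_nhdsGT_zero (neg_neg_of_pos hα)).comp
      (tendsto_nhdsWithin_iff.2 ⟨hρ, Eventually.of_forall hρpos⟩)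
  have hs : ∀ᶠ n in atTop, 0 < s n := by
    filter_upwards [hk.eventually_gt_atTop 0] with n hn
    exact mul_pos (by exact_mod_cast hn) (hρpos n)
  have hcont : ∀ n x, (c n : ℂ) * (ratFun γ β lm jp (w n + (s n : ℂ) * x) *
      exp (a₁ * (w n + (s n : ℂ) * x) + a₀)) ≠ 0 →
      ContinuousAt (fun ζ => (c n : ℂ) * (ratFun γ β lm jp (w n + (s n : ℂ) * ζ) *
        exp (a₁ * (w n + (s n : ℂ) * ζ) + a₀))) x := by
    intro n x hx
    have h1 := (div_ne_zero_iff.1 (left_ne_zero_of_mul (right_ne_zero_of_mul hx))).2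
    have h2 : ContinuousAt (fun ζ => ratFun γ β lm jp (w n + (s n : ℂ) * ζ)) x :=
      ContinuousAt.comp (f := fun ζ => w n + (s n : ℂ) * ζ) (continuousAt_ratFun h1) (by fun_prop)
    exact continuousAt_const.mul (h2.mul (by fun_prop))
  obtain ⟨ζ₁, hζ₁⟩ : ∃ ζ, g ζ ≠ 0 := by
    by_contra! h
    exact hnc 0 (funext h)
  obtain ⟨V, hgV, hV, hζ₁V⟩ := mem_nhds_iff.1
    ((hconv'.continuousAt hcont hζ₁).eventually_ne hζ₁)
  have hVne : V.Nonempty := ⟨ζ₁, hζ₁V⟩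
  let l : Ultrafilter ℕ := hyperfilter ℕ
  have hl : (l : Filter ℕ) ≤ atTop := Nat.hyperfilter_le_atTop
  have hF := fun ζ => (hconv'.sphTendsto ζ).mono hl
  have hcl := hc.mono_left hl
  have hsl := hs.filter_mono hl
  obtain ⟨s₀, hs₀⟩ : ∃ s₀, Tendsto s l (𝓝 s₀) := by
    rcases l.tendsto_nhds_or_cobounded (fun n => (s n : ℂ)) with ⟨x, hx⟩ | h
    · exact ⟨x.re, by simpa [Function.comp_def] using (continuous_re.tendsto x).comp hx⟩
    · refine absurd ?_ (not_tendsto_scale_atTop ha₁ l hcl hV hVne hgV hF)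
      refine (tendsto_norm_atTop_iff_cobounded.2 h).congr' ?_
      filter_upwards [hsl] with n hn
      simp [abs_of_pos hn]
  have hs₀_nonneg : 0 ≤ s₀ := ge_of_tendsto hs₀ (hsl.mono fun n hn => hn.le)
  rcases l.tendsto_nhds_or_cobounded w with ⟨w₀, hw⟩ | hw
  · right
    have hzero : ∀ ζ ∈ V, ∃ i, w₀ + (s₀ : ℂ) * ζ = γ i := fun ζ hζ =>
      exists_eq_zero_of_tendsto hcl hw hs₀ (hgV hζ) (hF ζ)
    have hs₀_zero : s₀ = 0 := by
      by_contra hne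
      have hne' : (s₀ : ℂ) ≠ 0 := by exact_mod_cast hne
      have hsub : V ⊆ Set.range fun i => (γ i - w₀) / s₀ := fun ζ hζ => by
        obtain ⟨i, hi⟩ := hzero ζ hζ
        refine ⟨i, ?_⟩
        simp only [← hi]
        field_simp
        ring
      exact infinite_of_mem_nhds ζ₁ (hV.mem_nhds hζ₁V) ((Set.finite_range _).subset hsub)
    subst hs₀_zero
    obtain ⟨i, hi⟩ := hzero ζ₁ hζ₁V
    obtain rfl : w₀ = γ i := by simpa using hi
    exact ⟨i, eq_pow_of_tendsto_zero hγ hγβ (hlm i) l hsl hcl hw hs₀ hnc hV hVne hgV hF⟩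
  · left
    obtain ⟨k₀, hk₀, h⟩ := eq_exp_of_tendsto_cobounded hw hs₀ hζ₁ hF
    refine ⟨k₀, s₀ * a₁, hk₀, ⟨s₀, hs₀_nonneg.lt_of_ne ?_, rfl⟩, funext h⟩
    rintro rfl
    exact hnc k₀ (funext fun ζ => by simp [h])

/-- `log (x n - b)` is negligible compared with `x n → ∞`. -/
lemma tendsto_log_sub_div {ι : Type*} {l : Filter ι} {x : ι → ℂ} (hx : Tendsto x l (cobounded ℂ))
    (b : ℂ) : Tendsto (fun n => log (x n - b) / x n) l (𝓝 0) := by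
  have hy : Tendsto (fun n => x n - b) l (cobounded ℂ) := (tendsto_sub_const_cobounded b).comp hx
  have hyn := tendsto_norm_atTop_iff_cobounded.2 hy
  have hlog : Tendsto (fun n => log (x n - b) / (x n - b)) l (𝓝 0) := by
    have h1 : Tendsto (fun n => Real.log ‖x n - b‖ / ‖x n - b‖) l (𝓝 0) :=
      Real.isLittleO_log_id_atTop.tendsto_div_nhds_zero.comp hyn
    have h2 : Tendsto (fun n => |Real.log ‖x n - b‖ / ‖x n - b‖| + Real.pi * ‖x n - b‖⁻¹) l
        (𝓝 0) := by
      simpa using h1.abs.add ((tendsto_inv_atTop_zero.comp hyn).const_mul Real.pi)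
    refine squeeze_zero_norm (fun n => ?_) h2
    rw [norm_div, abs_div, abs_norm, ← div_eq_mul_inv, ← add_div]
    gcongr
    calc ‖log (x n - b)‖ ≤ |(log (x n - b)).re| + |(log (x n - b)).im| := norm_le_abs_re_add_abs_im _
      _ ≤ _ := by
        rw [log_re, log_im]
        gcongr
        exact abs_arg_le_pi _
  have h3 : Tendsto (fun n => (x n - b) / x n) l (𝓝 1) := by
    have : Tendsto (fun n => 1 - b * (x n)⁻¹) l (𝓝 1) := by
      simpa using ((tendsto_inv₀_cobounded.comp hx).const_mul b).const_sub 1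
    refine this.congr' ?_
    filter_upwards [hx.eventually_ne_cobounded 0] with n hn
    field_simp
  have h4 := hlog.mul h3
  rw [zero_mul] at h4
  refine h4.congr' ?_
  filter_upwards [hy.eventually_ne_cobounded 0] with n hn
  field_simp

/-- A logarithm of `ratFun` along a sequence tending to infinity, negligible compared with the
sequence. -/
lemma exists_log_ratFun {ι : Type*} {l : Filter ι} {x : ι → ℂ} (hx : Tendsto x l (cobounded ℂ)) :
    ∃ L : ι → ℂ, (∀ᶠ n in l, exp (L n) = ratFun γ β lm jp (x n)) ∧
      Tendsto (fun n => L n / x n) l (𝓝 0) := by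
  refine ⟨fun n => ∑ i, lm i * log (x n - γ i) - ∑ j, jp j * log (x n - β j), ?_, ?_⟩
  · filter_upwards [eventually_all.2 fun i => hx.eventually_ne_cobounded (γ i),
      eventually_all.2 fun j => hx.eventually_ne_cobounded (β j)] with n h₁ h₂
    simp only [Complex.exp_sub, Complex.exp_sum, Complex.exp_nat_mul, ratFun]
    congr 1 <;> refine Finset.prod_congr rfl fun i _ => ?_
    · rw [exp_log (sub_ne_zero.2 (h₁ i))]
    · rw [exp_log (sub_ne_zero.2 (h₂ i))]
  · have h1 : Tendsto (fun n => ∑ i, lm i * (log (x n - γ i) / x n) -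
        ∑ j, jp j * (log (x n - β j) / x n)) l (𝓝 0) := by
      simpa using (tendsto_finsetSum Finset.univ fun i _ =>
        (tendsto_log_sub_div hx (γ i)).const_mul (lm i : ℂ)).sub
        (tendsto_finsetSum Finset.univ fun j _ =>
          (tendsto_log_sub_div hx (β j)).const_mul (jp j : ℂ))
    refine h1.congr fun n => ?_
    simp only [sub_div, Finset.sum_div, mul_div_assoc]

lemma exp_mem_piAlpha (ha₁ : a₁ ≠ 0) (hα : 0 < α) {k₀ : ℂ} (hk₀ : k₀ ≠ 0) {t : ℝ} (ht : 0 < t) :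
    (fun ζ => k₀ * exp ((t : ℂ) * a₁ * ζ)) ∈
      PiAlpha α fun z => ratFun γ β lm jp z * exp (a₁ * z + a₀) := by
  have htC : (t : ℂ) ≠ 0 := by exact_mod_cast ht.ne'
  set ρ : ℕ → ℝ := fun n => t / ((n : ℝ) + 1)
  have hn1 : Tendsto (fun n : ℕ => (n : ℝ) + 1) atTop atTop :=
    tendsto_atTop_add_const_right _ _ tendsto_natCast_atTop_atTop
  have hρpos : ∀ n, 0 < ρ n := fun n => by positivity
  have hρ : Tendsto ρ atTop (𝓝 0) := hn1.const_div_atTop t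
  have hlogρ : Tendsto (fun n => Real.log (ρ n)) atTop atBot :=
    Real.tendsto_log_nhdsGT_zero.comp
      (tendsto_nhdsWithin_iff.2 ⟨hρ, Eventually.of_forall hρpos⟩)
  set u : ℕ → ℂ := fun n => ((α * Real.log (ρ n) : ℝ) : ℂ) / a₁ with hu_def
  have hu : Tendsto u atTop (cobounded ℂ) := by
    rw [← tendsto_norm_atTop_iff_cobounded]
    simp only [hu_def, norm_div, norm_real, Real.norm_eq_abs]
    exact (tendsto_abs_atBot_atTop.comp (hlogρ.const_mul_atBot hα)).atTop_div_const
      (norm_pos_iff.2 ha₁)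
  obtain ⟨L, hL, hL0⟩ := exists_log_ratFun (γ := γ) (β := β) (lm := lm) (jp := jp) hu
  set w : ℕ → ℂ := fun n => u n + (log k₀ - a₀ - L n) / a₁ with hw_def
  have hwu : Tendsto (fun n => w n / u n) atTop (𝓝 1) := by
    have h1 : Tendsto (fun n => 1 + ((log k₀ - a₀) * (u n)⁻¹ - L n / u n) / a₁) atTop (𝓝 1) := by
      simpa using ((((tendsto_inv₀_cobounded.comp hu).const_mul (log k₀ - a₀)).sub
        hL0).div_const a₁).const_add 1
    refine h1.congr' ?_
    filter_upwards [hu.eventually_ne_cobounded 0] with n hn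
    simp only [hw_def]
    field_simp
  have hun : Tendsto (fun n : ℕ => u n / ((n : ℂ) + 1)) atTop (𝓝 0) := by
    have h1 : Tendsto (fun n : ℕ => α * (Real.log t * ((n : ℝ) + 1)⁻¹ -
        Real.log ((n : ℝ) + 1) / ((n : ℝ) + 1))) atTop (𝓝 0) := by
      simpa using (((tendsto_inv_atTop_zero.comp hn1).const_mul (Real.log t)).sub
        (Real.isLittleO_log_id_atTop.tendsto_div_nhds_zero.comp hn1)).const_mul α
    have h2 := ((continuous_ofReal.tendsto 0).comp h1).div_const a₁
    rw [ofReal_zero, zero_div] at h2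
    refine h2.congr fun n => ?_
    have h3 : Real.log (ρ n) = Real.log t - Real.log ((n : ℝ) + 1) :=
      Real.log_div ht.ne' (by positivity)
    simp only [Function.comp_apply, hu_def, h3]
    push_cast
    have : ((n : ℂ) + 1) ≠ 0 := Nat.cast_add_one_ne_zero n
    field_simp
  refine ⟨fun x _ => by fun_prop, fun b hb => ?_, 0, fun n => n + 1,
    fun n => w n / ((n : ℂ) + 1), ρ, tendsto_add_atTop_nat 1, ?_, hρpos, hρ, ?_⟩
  · have h0 := congrFun hb 0
    have h1 := congrFun hb (1 / (t * a₁))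
    rw [mul_one_div_cancel (mul_ne_zero htC ha₁), ← h0] at h1
    have h2 : exp 1 = 1 := by simpa [hk₀] using h1
    have h3 : Real.exp 1 = 1 := ofReal_injective (by simpa using h2)
    simp at h3
  · have h1 := hwu.mul hun
    rw [mul_zero] at h1
    refine h1.congr' ?_
    filter_upwards [hu.eventually_ne_cobounded 0] with n hn
    field_simp
  · refine SphLocUnifConv.of_tendsto (by fun_prop) fun ζ => ?_
    have hu' : Tendsto (fun q : ℕ × ℂ => u q.1) (atTop ×ˢ 𝓝 ζ) (cobounded ℂ) :=
      hu.comp tendsto_fst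
    have hy : Tendsto (fun q : ℕ × ℂ => (w q.1 + t * q.2) / u q.1) (atTop ×ˢ 𝓝 ζ) (𝓝 1) := by
      have hsnd : Tendsto (fun q : ℕ × ℂ => (t : ℂ) * q.2) (atTop ×ˢ 𝓝 ζ) (𝓝 (t * ζ)) :=
        tendsto_snd.const_mul _
      have := (hwu.comp tendsto_fst).add (hsnd.mul (tendsto_inv₀_cobounded.comp hu'))
      rw [mul_zero, add_zero] at this
      refine this.congr fun q => ?_
      simp only [Function.comp_apply]
      ring
    have hexp : Tendsto (fun q : ℕ × ℂ => k₀ * exp ((t : ℂ) * a₁ * q.2)) (atTop ×ˢ 𝓝 ζ)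
        (𝓝 (k₀ * exp ((t : ℂ) * a₁ * ζ))) :=
      (Continuous.tendsto (by fun_prop : Continuous fun ξ => k₀ * exp ((t : ℂ) * a₁ * ξ)) ζ).comp
        tendsto_snd
    have hlim := (tendsto_ratFun_div_one (γ := γ) (β := β) (lm := lm) (jp := jp) hu' hy).mul hexp
    rw [one_mul] at hlim
    refine hlim.congr' ?_
    filter_upwards [tendsto_fst.eventually hL] with q hq
    have hn : ((q.1 : ℂ) + 1) ≠ 0 := Nat.cast_add_one_ne_zero q.1
    have h1 : ((q.1 + 1 : ℕ) : ℂ) * (w q.1 / ((q.1 : ℂ) + 1)) +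
        ((q.1 + 1 : ℕ) : ℂ) * (ρ q.1 : ℂ) * q.2 = w q.1 + t * q.2 := by
      simp only [ρ]
      push_cast
      field_simp
    have h2 : exp (a₁ * (w q.1 + t * q.2) + a₀) =
        exp ((α * Real.log (ρ q.1) : ℝ) : ℂ) * k₀ / exp (L q.1) * exp (t * a₁ * q.2) := by
      rw [← exp_log hk₀, ← Complex.exp_add, ← Complex.exp_sub, ← Complex.exp_add]
      congr 1
      simp only [hw_def, hu_def]
      field_simp
      ring
    have h3 : ((ρ q.1 ^ (-α) : ℝ) : ℂ) * exp ((α * Real.log (ρ q.1) : ℝ) : ℂ) = 1 := by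
      rw [← ofReal_exp, ← ofReal_mul, Real.rpow_def_of_pos (hρpos _), ← Real.exp_add]
      simp [mul_comm]
    rw [h1, h2, hq]
    linear_combination (-ratFun γ β lm jp (w q.1 + t * q.2) / ratFun γ β lm jp (u q.1) *
      (k₀ * exp (t * a₁ * q.2))) * h3

lemma pow_mem_piAlpha (hγ : Function.Injective γ) (hγβ : ∀ i j, γ i ≠ β j) (i : Fin m)
    (hlm : 1 ≤ lm i) (hα₀ : 0 < α) (hα₁ : α < 1) (A₀ : ℂ) {A₁ : ℝ} (hA₁ : 0 < A₁) :
    (fun ζ => exp (a₁ * γ i + a₀) * ratCofactor γ β lm jp i (γ i) *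
        ((A₁ : ℂ) * ζ + A₀) ^ lm i) ∈
      PiAlpha α fun z => ratFun γ β lm jp z * exp (a₁ * z + a₀) := by
  have hAC : (A₁ : ℂ) ≠ 0 := by exact_mod_cast hA₁.ne'
  have hC0 : exp (a₁ * γ i + a₀) * ratCofactor γ β lm jp i (γ i) ≠ 0 :=
    mul_ne_zero (exp_ne_zero _) (ratCofactor_ne_zero hγ hγβ i)
  have hl1 : (1 : ℝ) ≤ lm i := by exact_mod_cast hlm
  have hlα : 0 < (lm i : ℝ) - α := by linarith
  set e : ℝ := lm i / (lm i - α) with he_def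
  have he : 1 < e := by rw [he_def, lt_div_iff₀ hlα]; linarith
  have hn1 : Tendsto (fun n : ℕ => (n : ℝ) + 1) atTop atTop :=
    tendsto_atTop_add_const_right _ _ tendsto_natCast_atTop_atTop
  set b : ℕ → ℝ := fun n => A₁ / ((n : ℝ) + 1) with hb_def
  have hbpos : ∀ n, 0 < b n := fun n => by positivity
  have hb : Tendsto b atTop (𝓝 0) := hn1.const_div_atTop A₁
  set ρ : ℕ → ℝ := fun n => b n ^ e with hρ_def
  have hρpos : ∀ n, 0 < ρ n := fun n => Real.rpow_pos_of_pos (hbpos n) _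
  have hrpow : ∀ r : ℝ, 0 < r → Tendsto (fun n => b n ^ r) atTop (𝓝 0) := fun r hr => by
    simpa [Real.zero_rpow hr.ne'] using hb.rpow_const (p := r) (Or.inr hr.le)
  have hρ : Tendsto ρ atTop (𝓝 0) := hrpow e (by linarith)
  set s : ℕ → ℝ := fun n => ((n : ℝ) + 1) * ρ n with hs_def
  have hs_eq : ∀ n, s n = A₁ * b n ^ (e - 1) := fun n => by
    have h1 : ((n : ℝ) + 1) ≠ 0 := by positivity
    simp only [hs_def, hρ_def]
    rw [Real.rpow_sub_one (hbpos n).ne']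
    simp only [hb_def]
    field_simp
  have hs : Tendsto s atTop (𝓝 0) := by
    have h1 := (hrpow (e - 1) (by linarith)).const_mul A₁
    rw [mul_zero] at h1
    exact h1.congr fun n => (hs_eq n).symm
  have hbal : ∀ n, ρ n ^ (-α) * s n ^ lm i = A₁ ^ lm i := fun n => by
    rw [hs_eq, mul_pow, hρ_def, ← Real.rpow_mul (hbpos n).le, ← Real.rpow_mul_natCast (hbpos n).le,
      mul_left_comm, ← Real.rpow_add (hbpos n)]
    have : e * -α + (e - 1) * lm i = 0 := by
      rw [he_def]
      field_simp
      ring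
    rw [this, Real.rpow_zero, mul_one]
  set w : ℕ → ℂ := fun n => γ i + s n * (A₀ / A₁) with hw_def
  have hsC : Tendsto (fun n => (s n : ℂ)) atTop (𝓝 0) := by
    simpa [Function.comp_def] using (continuous_ofReal.tendsto 0).comp hs
  have hw : Tendsto w atTop (𝓝 (γ i)) := by
    simpa using (hsC.mul_const (A₀ / A₁)).const_add (γ i)
  refine ⟨fun x _ => by fun_prop, fun d hd => ?_, 0, fun n => n + 1,
    fun n => w n / ((n : ℂ) + 1), ρ, tendsto_add_atTop_nat 1, ?_, hρpos, hρ, ?_⟩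
  · have h0 := congrFun hd (-A₀ / A₁)
    have h1 := congrFun hd ((1 - A₀) / A₁)
    rw [← h0, mul_div_cancel₀ _ hAC, mul_div_cancel₀ _ hAC] at h1
    simp [hC0, show lm i ≠ 0 by omega] at h1
  · have hinv : Tendsto (fun n : ℕ => ((n : ℂ) + 1)⁻¹) atTop (𝓝 0) := by
      simpa [Function.comp_def] using
        (continuous_ofReal.tendsto 0).comp (tendsto_inv_atTop_zero.comp hn1)
    simpa [div_eq_mul_inv] using hw.mul hinv
  · refine SphLocUnifConv.of_tendsto (by fun_prop) fun ζ => ?_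
    have hu : Tendsto (fun q : ℕ × ℂ => w q.1 + s q.1 * q.2) (atTop ×ˢ 𝓝 ζ) (𝓝 (γ i)) := by
      simpa using (hw.comp tendsto_fst).add ((hsC.comp tendsto_fst).mul tendsto_snd)
    have hcont : ContinuousAt (fun z => exp (a₁ * z + a₀) * ratCofactor γ β lm jp i z) (γ i) :=
      ContinuousAt.mul (by fun_prop) (continuousAt_ratCofactor hγβ i)
    have hpow : Tendsto (fun q : ℕ × ℂ => ((A₁ : ℂ) * q.2 + A₀) ^ lm i) (atTop ×ˢ 𝓝 ζ)
        (𝓝 (((A₁ : ℂ) * ζ + A₀) ^ lm i)) :=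
      ((tendsto_snd.const_mul _).add_const _).pow _
    refine ((hcont.tendsto.comp hu).mul hpow).congr fun q => ?_
    have hn : ((q.1 : ℂ) + 1) ≠ 0 := Nat.cast_add_one_ne_zero q.1
    have h1 : ((q.1 + 1 : ℕ) : ℂ) * (w q.1 / ((q.1 : ℂ) + 1)) +
        ((q.1 + 1 : ℕ) : ℂ) * (ρ q.1 : ℂ) * q.2 = w q.1 + s q.1 * q.2 := by
      simp only [hs_def]
      push_cast
      field_simp
    have h2 : w q.1 + s q.1 * q.2 - γ i = s q.1 * (q.2 + A₀ / A₁) := by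
      simp only [hw_def]
      ring
    have h3 : ((ρ q.1 ^ (-α) : ℝ) : ℂ) * (s q.1 : ℂ) ^ lm i = (A₁ : ℂ) ^ lm i := by
      exact_mod_cast congrArg ofReal (hbal q.1)
    have h4 : (A₁ : ℂ) * q.2 + A₀ = A₁ * (q.2 + A₀ / A₁) := by field_simp
    simp only [Function.comp_apply]
    rw [h1, ratFun_eq_mul_ratCofactor i, h2, h4, mul_pow, mul_pow, ← h3]
    ring

end Classification

/-- (Theorem 1, case `k = 1`, `0 < α < 1`) For `f = R·e^{a₁z + a₀}` with
`a₁ ≠ 0`: `Π_α(f) = { ζ ↦ k₀·e^{A₁ζ} : k₀ ≠ 0, arg A₁ = arg a₁ } ∪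
{ ζ ↦ e^{P(γ i)}·R̃_{γ i}(γ i)·(A₁ζ + A₀)^(l i) : i, A₀ ∈ ℂ, A₁ > 0 real }`. -/
theorem piAlpha_pos_linear
    (m p : ℕ) (γ : Fin m → ℂ) (β : Fin p → ℂ)
    (hγ : Function.Injective γ) (hβ : Function.Injective β) (hγβ : ∀ i j, γ i ≠ β j)
    (lm : Fin m → ℕ) (hlm : ∀ i, 1 ≤ lm i) (jp : Fin p → ℕ) (hjp : ∀ j, 1 ≤ jp j)
    (R : ℂ → ℂ) (hR : R = fun z => (∏ i, (z - γ i) ^ lm i) / ∏ j, (z - β j) ^ jp j)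
    (a₁ a₀ : ℂ) (ha₁ : a₁ ≠ 0)
    (f : ℂ → ℂ) (hf : f = fun z => R z * Complex.exp (a₁ * z + a₀))
    (α : ℝ) (hα₁ : 0 < α) (hα₂ : α < 1) :
    PiAlpha α f =
      { g | (∃ k₀ A₁ : ℂ, k₀ ≠ 0 ∧ (∃ t : ℝ, 0 < t ∧ A₁ = (t : ℂ) * a₁) ∧
              g = fun ζ => k₀ * Complex.exp (A₁ * ζ)) ∨
            (∃ (i : Fin m) (A₀ : ℂ) (A₁ : ℝ), 0 < A₁ ∧
              g = fun ζ => Complex.exp (a₁ * γ i + a₀) *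
                ((∏ j ∈ Finset.univ.erase i, (γ i - γ j) ^ lm j) /
                  ∏ j, (γ i - β j) ^ jp j) * ((A₁ : ℂ) * ζ + A₀) ^ lm i) } := by
  subst hR hf
  ext g
  refine ⟨eq_exp_or_eq_pow_of_mem_piAlpha hγ hγβ hlm ha₁ hα₁, ?_⟩
  rintro (⟨k₀, A₁, hk₀, ⟨t, ht, rfl⟩, rfl⟩ | ⟨i, A₀, A₁, hA₁, rfl⟩)
  · exact exp_mem_piAlpha ha₁ hα₁ hk₀ ht
  · exact pow_mem_piAlpha hγ hγβ i (hlm i) hα₁ hα₂ A₀ hA₁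
end
end
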